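/- Let (Ω, μ) be a probability space and n ∈ ℕ. The couple (V^1_1(Ω^n, L^1(ℝ)), V^1_1(Ω^n, L^2(ℝ))) is K-closed in (L^1(Ω^n, L^1(ℝ)), L^1(Ω^n, L^2(ℝ))) with a constant independent of n. That is, there is an absolute constant C such that for every f ∈ V^1_1(Ω^n, L^1(ℝ)) + V^1_1(Ω^n, L^2(ℝ)), every t > 0, and every decomposition f = f_0 + f_1 with f_0 ∈ L^1(Ω^n, L^1(ℝ)) and f_1 ∈ L^1(Ω^n, L^2(ℝ)), there exists a decomposition f = g_0 + g_1 with g_0 ∈ V^1_1(Ω^n, L^1(ℝ)), g_1 ∈ V^1_1(Ω^n, L^2(ℝ)), ‖g_0‖_{L^1(Ω^n,L^1(ℝ))} + t ‖g_1‖_{L^1(Ω^n,L^2(ℝ))} ≤ C (‖f_0‖_{L^1(Ω^n,L^1(ℝ))} + t ‖f_1‖_{L^1(Ω^n,L^2(ℝ))}). -/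

import Mathlib

open MeasureTheory
open scoped ENNReal

universe u

variable {Ω : Type u} [MeasurableSpace Ω]

/-- The norm of `L¹(Ω^n, L¹(ℝ))`. -/
noncomputable def normL1L1R (μ : Measure Ω) {n : ℕ} (F : (Fin n → Ω) → ℝ → ℝ) : ℝ≥0∞ :=
  ∫⁻ x : Fin n → Ω, ∫⁻ s : ℝ, ENNReal.ofReal |F x s| ∂volume ∂Measure.pi fun _ => μ

/-- The norm of `L¹(Ω^n, L²(ℝ))`. -/
noncomputable def normL1L2R (μ : Measure Ω) {n : ℕ} (F : (Fin n → Ω) → ℝ → ℝ) : ℝ≥0∞ :=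
  ∫⁻ x : Fin n → Ω, (∫⁻ s : ℝ, ENNReal.ofReal (F x s ^ 2) ∂volume) ^ ((1:ℝ)/2)
    ∂Measure.pi fun _ => μ

/-- Membership in `V^1_1(Ω^n, B)`, the closure in the Bochner space (with norm `N`, either
`L¹(Ω^n,L¹(ℝ))` or `L¹(Ω^n,L²(ℝ))`) of the span of functions `x ↦ ∑ i, g i (x i)` with
each `g i : Ω → B` of mean zero. -/
def MemV11 (μ : Measure Ω) {n : ℕ}
    (N : ((Fin n → Ω) → ℝ → ℝ) → ℝ≥0∞) (F : (Fin n → Ω) → ℝ → ℝ) : Prop :=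
  Measurable (Function.uncurry F) ∧ N F < ⊤ ∧
  ∀ ε : ℝ, 0 < ε → ∃ g : Fin n → Ω → ℝ → ℝ,
    (∀ i, Measurable (Function.uncurry (g i))) ∧
    (∀ i, ∀ᵐ s ∂(volume : Measure ℝ),
      Integrable (fun ω => g i ω s) μ ∧ ∫ ω, g i ω s ∂μ = 0) ∧
    (∀ i, N (fun x s => g i (x i) s) < ⊤) ∧
    N (fun x s => F x s - ∑ i, g i (x i) s) ≤ ENNReal.ofReal ε

namespace KCl

/-- The `L²(ν)` norm of a nonnegative function. -/
noncomputable def l2 {R : Type*} [MeasurableSpace R] (ν : Measure R) (φ : R → ℝ≥0∞) : ℝ≥0∞ :=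
  (∫⁻ s, φ s ^ 2 ∂ν) ^ ((1:ℝ)/2)

theorem sqrt_sq (a : ℝ≥0∞) : (a ^ ((1:ℝ)/2)) ^ 2 = a := by
  rw [← ENNReal.rpow_natCast, ← ENNReal.rpow_mul]; norm_num

theorem sq_sqrt (a : ℝ≥0∞) : (a ^ 2) ^ ((1:ℝ)/2) = a := by
  rw [← ENNReal.rpow_natCast, ← ENNReal.rpow_mul]; norm_num

theorem le_of_sq_le {a b : ℝ≥0∞} (h : a ^ 2 ≤ b ^ 2) : a ≤ b := by
  have := ENNReal.rpow_le_rpow h (by norm_num : (0:ℝ) ≤ 1/2)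
  rwa [sq_sqrt, sq_sqrt] at this

theorem sqrt_mono {a b : ℝ≥0∞} (h : a ≤ b) : a ^ ((1:ℝ)/2) ≤ b ^ ((1:ℝ)/2) :=
  ENNReal.rpow_le_rpow h (by norm_num)

section
variable {R : Type*} [MeasurableSpace R] {ν : Measure R}

theorem l2_sq (φ : R → ℝ≥0∞) : l2 ν φ ^ 2 = ∫⁻ s, φ s ^ 2 ∂ν := sqrt_sq _

theorem l2_mono {φ ψ : R → ℝ≥0∞} (h : ∀ s, φ s ≤ ψ s) : l2 ν φ ≤ l2 ν ψ :=
  sqrt_mono (lintegral_mono fun s => pow_le_pow_left' (h s) 2)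

theorem l2_mono_ae {φ ψ : R → ℝ≥0∞} (h : ∀ᵐ s ∂ν, φ s ≤ ψ s) : l2 ν φ ≤ l2 ν ψ :=
  sqrt_mono (lintegral_mono_ae (h.mono fun _ hs => pow_le_pow_left' hs 2))

theorem cauchy_schwarz {φ ψ : R → ℝ≥0∞} (hφ : Measurable φ) (hψ : Measurable ψ) :
    ∫⁻ s, φ s * ψ s ∂ν ≤ l2 ν φ * l2 ν ψ := by
  have := ENNReal.lintegral_mul_le_Lp_mul_Lq ν (p := 2) (q := 2)
    (Real.HolderConjugate.two_two) hφ.aemeasurable hψ.aemeasurable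
  simpa [l2] using this

theorem l2_const_mul (a : ℝ≥0∞) {φ : R → ℝ≥0∞} (hφ : Measurable φ) :
    l2 ν (fun s => a * φ s) = a * l2 ν φ := by
  unfold l2
  simp_rw [mul_pow]
  rw [lintegral_const_mul _ (hφ.pow_const 2), ENNReal.mul_rpow_of_nonneg _ _ (by norm_num), sq_sqrt]

theorem measurable_l2 {X : Type*} [MeasurableSpace X] [SFinite ν] {φ : X → R → ℝ≥0∞}
    (hφ : Measurable (Function.uncurry φ)) : Measurable fun x => l2 ν (φ x) := by
  unfold l2
  exact (Measurable.lintegral_prod_right' (f := fun z : X × R => φ z.1 z.2 ^ 2)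
    (hφ.pow_const 2)).pow_const _

theorem minkowski {X : Type*} [MeasurableSpace X] (P : Measure X) [SFinite P] [SFinite ν]
    {φ : X → R → ℝ≥0∞} (hφ : Measurable (Function.uncurry φ)) :
    l2 ν (fun s => ∫⁻ x, φ x s ∂P) ≤ ∫⁻ x, l2 ν (φ x) ∂P := by
  apply le_of_sq_le
  rw [l2_sq]
  have hx : ∀ x, Measurable (φ x) := fun x => hφ.comp measurable_prodMk_left
  have hs : ∀ s, Measurable (fun x => φ x s) := fun s => hφ.comp measurable_prodMk_right
  have hm3 : Measurable (fun p : (R × X) × X => φ p.1.2 p.1.1 * φ p.2 p.1.1) := by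
    apply Measurable.mul
    · exact hφ.comp (Measurable.prodMk (by fun_prop) (by fun_prop))
    · exact hφ.comp (Measurable.prodMk (by fun_prop) (by fun_prop))
  have hW := measurable_l2 (ν := ν) hφ
  calc ∫⁻ s, (∫⁻ x, φ x s ∂P) ^ 2 ∂ν
      = ∫⁻ s, ∫⁻ x, ∫⁻ y, φ x s * φ y s ∂P ∂P ∂ν := by
        refine lintegral_congr fun s => ?_
        rw [sq, ← lintegral_mul_const _ (hs s)]
        exact lintegral_congr fun x => (lintegral_const_mul _ (hs s)).symm
    _ = ∫⁻ x, ∫⁻ s, ∫⁻ y, φ x s * φ y s ∂P ∂ν ∂P :=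
        lintegral_lintegral_swap (Measurable.lintegral_prod_right' hm3).aemeasurable
    _ = ∫⁻ x, ∫⁻ y, ∫⁻ s, φ x s * φ y s ∂ν ∂P ∂P := by
        refine lintegral_congr fun x => ?_
        refine lintegral_lintegral_swap (Measurable.aemeasurable ?_)
        exact hm3.comp (f := fun q : R × X => (((q.1, x), q.2) : (R × X) × X)) (by fun_prop)
    _ ≤ ∫⁻ x, ∫⁻ y, l2 ν (φ x) * l2 ν (φ y) ∂P ∂P :=
        lintegral_mono fun x => lintegral_mono fun y => cauchy_schwarz (hx x) (hx y)
    _ = (∫⁻ x, l2 ν (φ x) ∂P) ^ 2 := by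
        rw [sq, ← lintegral_mul_const _ hW]
        exact lintegral_congr fun x => lintegral_const_mul _ hW

theorem l2_add_le [SFinite ν] {φ ψ : R → ℝ≥0∞} (hφ : Measurable φ) (hψ : Measurable ψ) :
    l2 ν (fun s => φ s + ψ s) ≤ l2 ν φ + l2 ν ψ := by
  have h := ENNReal.lintegral_Lp_add_le (μ := ν) (p := 2) hφ.aemeasurable hψ.aemeasurable
    (by norm_num)
  simpa [l2] using h

theorem l2_sum_le [SFinite ν] {ι : Type*} (T : Finset ι) {φ : ι → R → ℝ≥0∞}
    (hφ : ∀ i, Measurable (φ i)) :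
    l2 ν (fun s => ∑ i ∈ T, φ i s) ≤ ∑ i ∈ T, l2 ν (φ i) := by
  classical
  induction T using Finset.induction_on with
  | empty => simp [l2]
  | insert a T ha ih =>
    simp only [Finset.sum_insert ha]
    exact (l2_add_le (hφ a) (Finset.measurable_sum T fun i _ => hφ i)).trans (by gcongr)

end

/-! ### product measure facts -/

theorem mp_piecewise (μ : Measure Ω) [IsProbabilityMeasure μ] {n : ℕ} (A : Finset (Fin n)) :
    MeasurePreserving (fun p : (Fin n → Ω) × (Fin n → Ω) => A.piecewise p.1 p.2)
      ((Measure.pi fun _ => μ).prod (Measure.pi fun _ => μ)) (Measure.pi fun _ => μ) := by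
  have hm : Measurable (fun p : (Fin n → Ω) × (Fin n → Ω) => A.piecewise p.1 p.2) := by
    refine measurable_pi_lambda _ fun i => ?_
    by_cases h : i ∈ A
    · simp only [Finset.piecewise, h, if_true]; fun_prop
    · simp only [Finset.piecewise, h, if_false]; fun_prop
  refine ⟨hm, ?_⟩
  symm
  refine Measure.pi_eq fun s hs => ?_
  rw [Measure.map_apply hm (MeasurableSet.univ_pi hs)]
  have : (fun p : (Fin n → Ω) × (Fin n → Ω) => A.piecewise p.1 p.2) ⁻¹' (Set.univ.pi s)
      = (Set.univ.pi fun i => if i ∈ A then s i else Set.univ) ×ˢ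
        (Set.univ.pi fun i => if i ∈ A then Set.univ else s i) := by
    ext p
    simp only [Set.mem_preimage, Set.mem_pi, Set.mem_univ, true_imp_iff, Set.mem_prod, ← forall_and]
    refine forall_congr' fun i => ?_
    by_cases h : i ∈ A <;> simp [Finset.piecewise, h]
  rw [this, Measure.prod_prod, Measure.pi_pi, Measure.pi_pi, ← Finset.prod_mul_distrib]
  refine Finset.prod_congr rfl fun i _ => ?_
  by_cases h : i ∈ A <;> simp [h]

theorem mp_update (μ : Measure Ω) [IsProbabilityMeasure μ] {n : ℕ} (i : Fin n) :
    MeasurePreserving (fun p : Ω × (Fin n → Ω) => Function.update p.2 i p.1)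
      (μ.prod (Measure.pi fun _ => μ)) (Measure.pi fun _ => μ) := by
  have hm : Measurable (fun p : Ω × (Fin n → Ω) => Function.update p.2 i p.1) :=
    measurable_update'.comp measurable_swap
  refine ⟨hm, ?_⟩
  symm
  refine Measure.pi_eq fun s hs => ?_
  rw [Measure.map_apply hm (MeasurableSet.univ_pi hs)]
  have : (fun p : Ω × (Fin n → Ω) => Function.update p.2 i p.1) ⁻¹' (Set.univ.pi s)
      = s i ×ˢ (Set.univ.pi fun j => if j = i then Set.univ else s j) := by
    ext p
    simp only [Set.mem_preimage, Set.mem_pi, Set.mem_univ, true_imp_iff, Set.mem_prod]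
    constructor
    · intro h
      refine ⟨by simpa using h i, fun j => ?_⟩
      by_cases hj : j = i
      · simp [hj]
      · simpa [hj] using h j
    · rintro ⟨h1, h2⟩ j
      by_cases hj : j = i
      · subst hj; simpa using h1
      · simpa [hj] using h2 j
  rw [this, Measure.prod_prod, Measure.pi_pi, ← Finset.mul_prod_erase _ _ (Finset.mem_univ i),
    ← Finset.mul_prod_erase _ (fun j => μ (s j)) (Finset.mem_univ i)]
  simp only [if_true, measure_univ, one_mul]
  congr 1
  refine Finset.prod_congr rfl fun j hj => ?_
  simp [Finset.ne_of_mem_erase hj]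

theorem lintegral_eval (μ : Measure Ω) [IsProbabilityMeasure μ] {n : ℕ} (i : Fin n)
    {φ : Ω → ℝ≥0∞} (hφ : Measurable φ) :
    ∫⁻ x : Fin n → Ω, φ (x i) ∂(Measure.pi fun _ => μ) = ∫⁻ ω, φ ω ∂μ :=
  (measurePreserving_eval (fun _ : Fin n => μ) i).lintegral_comp hφ

theorem lintegral_update (μ : Measure Ω) [IsProbabilityMeasure μ] {n : ℕ} (i : Fin n)
    {φ : (Fin n → Ω) → ℝ≥0∞} (hφ : Measurable φ) :
    ∫⁻ ω, ∫⁻ x : Fin n → Ω, φ (Function.update x i ω) ∂(Measure.pi fun _ => μ) ∂μ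
      = ∫⁻ x, φ x ∂(Measure.pi fun _ => μ) := by
  rw [← (mp_update μ i).lintegral_comp hφ, lintegral_prod]
  exact (hφ.comp (mp_update μ i).measurable).aemeasurable

theorem lintegral_piecewise (μ : Measure Ω) [IsProbabilityMeasure μ] {n : ℕ} (A : Finset (Fin n))
    {φ : (Fin n → Ω) → ℝ≥0∞} (hφ : Measurable φ) :
    ∫⁻ x, ∫⁻ y : Fin n → Ω, φ (A.piecewise x y) ∂(Measure.pi fun _ => μ) ∂(Measure.pi fun _ => μ)
      = ∫⁻ x, φ x ∂(Measure.pi fun _ => μ) := by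
  rw [← (mp_piecewise μ A).lintegral_comp hφ, lintegral_prod]
  exact (hφ.comp (mp_piecewise μ A).measurable).aemeasurable

theorem lintegral_piecewise' (μ : Measure Ω) [IsProbabilityMeasure μ] {n : ℕ} (A : Finset (Fin n))
    {φ : (Fin n → Ω) → ℝ≥0∞} (hφ : Measurable φ) :
    ∫⁻ x, ∫⁻ y : Fin n → Ω, φ (A.piecewise y x) ∂(Measure.pi fun _ => μ) ∂(Measure.pi fun _ => μ)
      = ∫⁻ x, φ x ∂(Measure.pi fun _ => μ) := by
  rw [lintegral_lintegral_swap, lintegral_piecewise μ A hφ]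
  exact (hφ.comp ((mp_piecewise μ A).measurable.comp measurable_swap)).aemeasurable

/-! ### Khintchine -/

theorem khintchine_moments {ι : Type*} [DecidableEq ι] (a : ι → ℝ) (T : Finset ι) :
    (∑ A ∈ T.powerset, (∑ i ∈ T, if i ∈ A then a i else - a i) ^ 2
        = 2 ^ T.card * ∑ i ∈ T, a i ^ 2) ∧
    (∑ A ∈ T.powerset, (∑ i ∈ T, if i ∈ A then a i else - a i) ^ 4
        ≤ 3 * 2 ^ T.card * (∑ i ∈ T, a i ^ 2) ^ 2) := by
  induction T using Finset.induction_on with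
  | empty => simp
  | insert j T hj ih =>
    obtain ⟨h2, h4⟩ := ih
    have key : ∀ k : ℕ, ∑ A ∈ (insert j T).powerset,
        (∑ i ∈ insert j T, if i ∈ A then a i else - a i) ^ k
        = ∑ A ∈ T.powerset, (((∑ i ∈ T, if i ∈ A then a i else - a i) - a j) ^ k
            + ((∑ i ∈ T, if i ∈ A then a i else - a i) + a j) ^ k) := by
      intro k
      rw [Finset.sum_powerset_insert hj, ← Finset.sum_add_distrib]
      refine Finset.sum_congr rfl fun A hA => ?_
      have hjA : j ∉ A := fun h => hj (Finset.mem_powerset.1 hA h)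
      congr 2
      · rw [Finset.sum_insert hj, if_neg hjA]; ring
      · rw [Finset.sum_insert hj, if_pos (Finset.mem_insert_self _ _), add_comm]
        congr 1
        refine Finset.sum_congr rfl fun i hi => ?_
        have : i ≠ j := fun h => hj (h ▸ hi)
        simp [Finset.mem_insert, this]
    have hcard : (T.powerset.card : ℝ) = 2 ^ T.card := by simp [Finset.card_powerset]
    rw [key, key, Finset.card_insert_of_notMem hj, Finset.sum_insert hj]
    set X : Finset ι → ℝ := fun A => ∑ i ∈ T, if i ∈ A then a i else - a i
    have e2 : ∑ A ∈ T.powerset, ((X A - a j) ^ 2 + (X A + a j) ^ 2)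
        = 2 * ∑ A ∈ T.powerset, X A ^ 2 + 2 ^ T.card * (2 * a j ^ 2) := by
      rw [← hcard, Finset.mul_sum, ← nsmul_eq_mul, ← Finset.sum_const, ← Finset.sum_add_distrib]
      exact Finset.sum_congr rfl fun A _ => by ring
    have e4 : ∑ A ∈ T.powerset, ((X A - a j) ^ 4 + (X A + a j) ^ 4)
        = 2 * ∑ A ∈ T.powerset, X A ^ 4 + 12 * a j ^ 2 * ∑ A ∈ T.powerset, X A ^ 2
          + 2 ^ T.card * (2 * a j ^ 4) := by
      rw [← hcard, Finset.mul_sum, Finset.mul_sum, ← nsmul_eq_mul, ← Finset.sum_const,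
        ← Finset.sum_add_distrib, ← Finset.sum_add_distrib]
      exact Finset.sum_congr rfl fun A _ => by ring
    rw [e2, e4, h2]
    refine ⟨by ring, ?_⟩
    have hp : (0:ℝ) ≤ 2 ^ T.card * a j ^ 4 := by positivity
    change ∑ A ∈ T.powerset, X A ^ 4 ≤ _ at h4
    set Q := ∑ i ∈ T, a i ^ 2
    have e5 : 3 * 2 ^ (T.card + 1) * (a j ^ 2 + Q) ^ 2
        = 2 * (3 * 2 ^ T.card * Q ^ 2) + 12 * a j ^ 2 * (2 ^ T.card * Q)
          + 6 * (2 ^ T.card * a j ^ 4) := by ring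
    rw [e5]
    linarith

theorem poly_ineq {y : ℝ} (hy : 0 ≤ y) : y ^ 2 ≤ y + 4 / 27 * y ^ 4 := by
  nlinarith [mul_nonneg hy (mul_nonneg (sq_nonneg (2 * y - 3)) (by linarith : (0:ℝ) ≤ y + 3))]

theorem khintchine {n : ℕ} (a : Fin n → ℝ) :
    Real.sqrt (∑ i, a i ^ 2) ≤
      2 * ((2 ^ n)⁻¹ * ∑ A : Finset (Fin n), |∑ i, if i ∈ A then a i else - a i|) := by
  obtain ⟨h2, h4⟩ := khintchine_moments a Finset.univ
  rw [Finset.powerset_univ] at h2 h4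
  simp only [Finset.card_univ, Fintype.card_fin] at h2 h4
  set X : Finset (Fin n) → ℝ := fun A => ∑ i, if i ∈ A then a i else - a i with hX
  change ∑ A, X A ^ 2 = _ at h2
  change ∑ A, X A ^ 4 ≤ _ at h4
  change _ ≤ 2 * ((2 ^ n)⁻¹ * ∑ A, |X A|)
  set S := Real.sqrt (∑ i, a i ^ 2) with hS
  have hS2 : S ^ 2 = ∑ i, a i ^ 2 := Real.sq_sqrt (Finset.sum_nonneg fun i _ => sq_nonneg _)
  have hS0 : 0 ≤ S := Real.sqrt_nonneg _
  rcases hS0.eq_or_lt with h0 | hpos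
  · rw [← h0]; positivity
  rw [← hS2] at h2 h4
  have hpt : ∀ A, S ^ 2 * X A ^ 2 ≤ S ^ 3 * |X A| + 4 / 27 * X A ^ 4 := by
    intro A
    have := poly_ineq (y := |X A| / S) (by positivity)
    have h' := mul_le_mul_of_nonneg_left this (by positivity : 0 ≤ S ^ 4)
    have e1 : S ^ 4 * (|X A| / S) ^ 2 = S ^ 2 * X A ^ 2 := by
      rw [div_pow, sq_abs]; field_simp
    have e2 : S ^ 4 * (|X A| / S + 4 / 27 * (|X A| / S) ^ 4)
        = S ^ 3 * |X A| + 4 / 27 * X A ^ 4 := by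
      rw [div_pow, (by norm_num : (4:ℕ) = 2 * 2), pow_mul |X A|, sq_abs]; field_simp; ring
    rwa [e1, e2] at h'
  have hsum := Finset.sum_le_sum fun A (_ : A ∈ Finset.univ) => hpt A
  rw [Finset.sum_add_distrib, ← Finset.mul_sum, ← Finset.mul_sum, ← Finset.mul_sum, h2] at hsum
  have hN : (0:ℝ) < 2 ^ n := by positivity
  have h5 : S ^ 3 * ((5/9) * (2 ^ n * S)) ≤ S ^ 3 * ∑ A, |X A| := by nlinarith
  have h6 := le_of_mul_le_mul_left h5 (by positivity)
  have h7 : S ≤ 9/5 * ((2 ^ n)⁻¹ * ∑ A, |X A|) := by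
    have := mul_le_mul_of_nonneg_left h6 (by positivity : (0:ℝ) ≤ 9/5 * (2 ^ n)⁻¹)
    calc S = 9/5 * (2 ^ n)⁻¹ * ((5/9) * (2 ^ n * S)) := by field_simp
      _ ≤ _ := this
      _ = _ := by ring
  have h8 : 0 ≤ (2 ^ n : ℝ)⁻¹ * ∑ A, |X A| := by positivity
  linarith

theorem khintchine_enorm {n : ℕ} (a : Fin n → ℝ) :
    ∑ i, ‖a i‖ₑ ^ 2 ≤
      (2 * ((2 ^ n)⁻¹ * ∑ A : Finset (Fin n), ‖∑ i, if i ∈ A then a i else - a i‖ₑ)) ^ 2 := by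
  have h := khintchine a
  have h1 : ∑ i, a i ^ 2 ≤ (2 * ((2 ^ n)⁻¹ *
      ∑ A : Finset (Fin n), |∑ i, if i ∈ A then a i else - a i|)) ^ 2 := by
    rwa [← Real.sqrt_le_left (by positivity)]
  have h2 := ENNReal.ofReal_le_ofReal h1
  rw [ENNReal.ofReal_sum_of_nonneg fun i _ => sq_nonneg _, ENNReal.ofReal_pow (by positivity),
    ENNReal.ofReal_mul (by norm_num), ENNReal.ofReal_mul (by positivity),
    ENNReal.ofReal_sum_of_nonneg fun i _ => abs_nonneg _,
    ENNReal.ofReal_inv_of_pos (by positivity), ENNReal.ofReal_pow (by norm_num)] at h2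
  simp only [← Real.enorm_eq_ofReal_abs, ENNReal.ofReal_ofNat] at h2
  convert h2 using 2 with i
  rw [Real.enorm_eq_ofReal_abs, ← ENNReal.ofReal_pow (abs_nonneg _), sq_abs]

end KCl

namespace KCl

theorem second_moment (μ : Measure Ω) [IsProbabilityMeasure μ] {n : ℕ} (L : ℝ≥0∞)
    {X : Fin n → Ω → ℝ≥0∞} (hX : ∀ i, Measurable (X i)) (hXL : ∀ i ω, X i ω ≤ L) :
    ∫⁻ x : Fin n → Ω, (∑ i, X i (x i)) ^ 2 ∂(Measure.pi fun _ => μ)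
      ≤ L * (∑ i, ∫⁻ ω, X i ω ∂μ) + (∑ i, ∫⁻ ω, X i ω ∂μ) ^ 2 := by
  have hXi : ∀ i, Measurable fun x : Fin n → Ω => X i (x i) := fun i =>
    (hX i).comp (measurable_pi_apply i)
  have hind := ProbabilityTheory.iIndepFun_pi (μ := fun _ : Fin n => μ) (X := X)
    (fun i => (hX i).aemeasurable)
  have hij : ∀ i j, ∫⁻ x : Fin n → Ω, X i (x i) * X j (x j) ∂(Measure.pi fun _ => μ)
      ≤ (∫⁻ ω, X i ω ∂μ) * (∫⁻ ω, X j ω ∂μ) + if i = j then L * ∫⁻ ω, X i ω ∂μ else 0 := by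
    intro i j
    by_cases h : i = j
    · subst h
      rw [if_pos rfl]
      refine le_trans ?_ le_add_self
      rw [← lintegral_eval μ i (hX i), ← lintegral_const_mul _ (hXi i)]
      exact lintegral_mono fun x => mul_le_mul_left (hXL i _) _
    · rw [if_neg h, add_zero,
        ProbabilityTheory.lintegral_mul_eq_lintegral_mul_lintegral_of_indepFun''
          (hXi i).aemeasurable (hXi j).aemeasurable (hind.indepFun h),
        lintegral_eval μ i (hX i), lintegral_eval μ j (hX j)]
  calc ∫⁻ x : Fin n → Ω, (∑ i, X i (x i)) ^ 2 ∂(Measure.pi fun _ => μ)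
      = ∑ i, ∑ j, ∫⁻ x : Fin n → Ω, X i (x i) * X j (x j) ∂(Measure.pi fun _ => μ) := by
        simp_rw [sq, Finset.sum_mul_sum]
        have hmm : ∀ i j, Measurable fun x : Fin n → Ω => X i (x i) * X j (x j) :=
          fun i j => (hXi i).mul (hXi j)
        rw [lintegral_finsetSum _ fun i _ => Finset.measurable_fun_sum _ fun j _ => hmm i j]
        exact Finset.sum_congr rfl fun i _ => lintegral_finsetSum _ fun j _ => hmm i j
    _ ≤ ∑ i, ∑ j, ((∫⁻ ω, X i ω ∂μ) * (∫⁻ ω, X j ω ∂μ)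
          + if i = j then L * ∫⁻ ω, X i ω ∂μ else 0) :=
        Finset.sum_le_sum fun i _ => Finset.sum_le_sum fun j _ => hij i j
    _ = _ := by
        simp_rw [Finset.sum_add_distrib]
        rw [add_comm, sq, Finset.sum_mul_sum]
        congr 1
        simp [Finset.mul_sum]

theorem trunc_cond {X : Type*} [MeasurableSpace X] (P : Measure X) {q : X → ℝ≥0∞}
    (hq : Measurable q) {Q L : ℝ≥0∞} (hqQ : ∀ x, q x ≤ Q) (hQ : Q ≠ ⊤)
    (h : Q / 2 ≤ ∫⁻ x, q x ∂P) : min Q L / 2 ≤ ∫⁻ x, min (q x) L ∂P := by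
  rcases le_or_gt Q L with hl | hl
  · rw [min_eq_left hl]
    refine h.trans (lintegral_mono fun x => ?_)
    exact le_min le_rfl ((hqQ x).trans hl)
  · rw [min_eq_right hl.le]
    have hQ0 : Q ≠ 0 := (bot_le.trans_lt hl).ne'
    have hpt : ∀ x, L / Q * q x ≤ min (q x) L := by
      intro x
      refine le_min ?_ ?_
      · calc L / Q * q x ≤ 1 * q x := by
              gcongr; exact ENNReal.div_le_of_le_mul (by simpa using hl.le)
          _ = q x := one_mul _
      · calc L / Q * q x ≤ L / Q * Q := by gcongr; exact hqQ x
          _ = L := ENNReal.div_mul_cancel hQ0 hQ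
    calc L / 2 = L / Q * (Q / 2) := by
          rw [← mul_div_assoc, ENNReal.div_mul_cancel hQ0 hQ]
      _ ≤ L / Q * ∫⁻ x, q x ∂P := by gcongr
      _ = ∫⁻ x, L / Q * q x ∂P := (lintegral_const_mul _ hq).symm
      _ ≤ _ := lintegral_mono hpt

theorem real_core {r N τ : ℝ} (hr : 0 < r) (hN : 0 ≤ N) (hτ : 0 < τ)
    (hτ2 : τ ^ 2 * (16 * (r ^ 2 + N)) = 27 * r ^ 2)
    (h : τ * r ^ 2 * (N / 2) ≤ r ^ 3 * (r / 32) + 4 / 27 * τ ^ 3 * (r ^ 2 * N + N ^ 2)) :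
    N ≤ r ^ 2 / 8 := by
  have e : 4 / 27 * τ ^ 3 * (r ^ 2 * N + N ^ 2) = τ * N * r ^ 2 / 4 := by
    have : 4 / 27 * τ ^ 3 * (r ^ 2 * N + N ^ 2)
      = 4 / 27 / 16 * τ * N * (τ ^ 2 * (16 * (r ^ 2 + N))) := by ring
    rw [this, hτ2]; ring
  rw [e] at h
  have hr2 : 0 < r ^ 2 := by positivity
  have h1 : τ * N ≤ r ^ 2 / 8 := by
    have : r ^ 2 * (τ * N) ≤ r ^ 2 * (r ^ 2 / 8) := by nlinarith
    exact le_of_mul_le_mul_left this hr2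
  have h2 : (τ * N) ^ 2 ≤ (r ^ 2 / 8) ^ 2 := pow_le_pow_left₀ (by positivity) h1 2
  have h3 : 27 * r ^ 2 * N ^ 2 ≤ (r ^ 2 / 8) ^ 2 * (16 * (r ^ 2 + N)) := by
    have := mul_le_mul_of_nonneg_right h2 (by positivity : 0 ≤ 16 * (r ^ 2 + N))
    calc _ = (τ * N) ^ 2 * (16 * (r ^ 2 + N)) := by rw [← hτ2]; ring
      _ ≤ _ := this
  have h4 : r ^ 2 * (108 * N ^ 2) ≤ r ^ 2 * (r ^ 2 * (r ^ 2 + N)) := by nlinarith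
  have h5 := le_of_mul_le_mul_left h4 hr2
  by_contra hc
  push Not at hc
  nlinarith

theorem enn_poly {r τ : ℝ} (hr : 0 < r) (hτ : 0 < τ) {Y : ℝ≥0∞} (hY : Y ≠ ⊤) :
    ENNReal.ofReal (τ * r ^ 2) * Y ≤ ENNReal.ofReal (r ^ 3) * Y ^ ((1:ℝ)/2)
      + ENNReal.ofReal (4 / 27 * τ ^ 3) * Y ^ 2 := by
  set y := (Y.toReal) ^ ((1:ℝ)/2) with hy
  have hy0 : 0 ≤ y := by positivity
  have hYy : Y.toReal = y ^ 2 := by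
    rw [hy, ← Real.rpow_natCast, ← Real.rpow_mul ENNReal.toReal_nonneg]; norm_num
  have hYs : Y ^ ((1:ℝ)/2) = ENNReal.ofReal y := by
    rw [hy, ← ENNReal.ofReal_rpow_of_nonneg ENNReal.toReal_nonneg (by norm_num),
      ENNReal.ofReal_toReal hY]
  have hYe : Y = ENNReal.ofReal (y ^ 2) := by rw [← hYy, ENNReal.ofReal_toReal hY]
  rw [hYs, hYe, ← ENNReal.ofReal_pow (by positivity), ← ENNReal.ofReal_mul (by positivity),
    ← ENNReal.ofReal_mul (by positivity), ← ENNReal.ofReal_mul (by positivity),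
    ← ENNReal.ofReal_add (by positivity) (by positivity)]
  apply ENNReal.ofReal_le_ofReal
  have := poly_ineq (y := τ * y / r) (by positivity)
  have h' := mul_le_mul_of_nonneg_left this (by positivity : 0 ≤ r ^ 4 / τ)
  have e1 : r ^ 4 / τ * (τ * y / r) ^ 2 = τ * r ^ 2 * y ^ 2 := by field_simp
  have e2 : r ^ 4 / τ * (τ * y / r + 4 / 27 * (τ * y / r) ^ 4)
      = r ^ 3 * y + 4 / 27 * τ ^ 3 * (y ^ 2) ^ 2 := by field_simp
  rwa [e1, e2] at h'

theorem lemA1 (μ : Measure Ω) [IsProbabilityMeasure μ] {n : ℕ}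
    {q : Fin n → (Fin n → Ω) → ℝ≥0∞} {Q : Fin n → Ω → ℝ≥0∞}
    (hq : ∀ i, Measurable (q i)) (hQ : ∀ i, Measurable (Q i))
    (hqQ : ∀ i x, q i x ≤ Q i (x i)) (hfin : ∀ i, ∀ᵐ ω ∂μ, Q i ω ≠ ⊤)
    (hE : ∀ i ω, Q i ω / 2 ≤ ∫⁻ x, q i (Function.update x i ω) ∂(Measure.pi fun _ => μ))
    {r : ℝ} (hr : 0 < r)
    (hm : ∫⁻ x, (∑ i, q i x) ^ ((1:ℝ)/2) ∂(Measure.pi fun _ => μ) ≤ ENNReal.ofReal (r / 32)) :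
    ∑ i, ∫⁻ ω, min (Q i ω) (ENNReal.ofReal (r ^ 2)) ∂μ ≤ ENNReal.ofReal (r ^ 2 / 8) := by
  set L := ENNReal.ofReal (r ^ 2) with hL
  set P : Measure (Fin n → Ω) := Measure.pi fun _ => μ with hP
  set N := ∑ i, ∫⁻ ω, min (Q i ω) L ∂μ with hN
  have hNtop : N ≠ ⊤ := by
    rw [hN, ← lt_top_iff_ne_top, ENNReal.sum_lt_top]
    intro i _
    calc ∫⁻ ω, min (Q i ω) L ∂μ ≤ ∫⁻ ω, L ∂μ := lintegral_mono fun ω => min_le_right _ _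
      _ < ⊤ := by simp [hL]
  have hqm : ∀ i, Measurable fun x => min (q i x) L := fun i => (hq i).min measurable_const
  set Y : (Fin n → Ω) → ℝ≥0∞ := fun x => ∑ i, min (q i x) L with hY
  have hYm : Measurable Y := Finset.measurable_sum _ fun i _ => hqm i
  have hYtop : ∀ x, Y x ≠ ⊤ := by
    intro x
    rw [hY, ← lt_top_iff_ne_top]; dsimp only; rw [ENNReal.sum_lt_top]
    exact fun i _ => (min_le_right _ _).trans_lt ENNReal.ofReal_lt_top
  have hEY : N / 2 ≤ ∫⁻ x, Y x ∂P := by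
    rw [hY, lintegral_finsetSum _ fun i _ => hqm i, hN, div_eq_mul_inv, Finset.sum_mul]
    refine Finset.sum_le_sum fun i _ => ?_
    rw [← lintegral_update μ i (hqm i), ← lintegral_mul_const _ ((hQ i).min measurable_const)]
    refine lintegral_mono_ae ((hfin i).mono fun ω hω => ?_)
    have := trunc_cond P (q := fun x => q i (Function.update x i ω)) (L := L)
      ((hq i).comp ((mp_update μ i).measurable.comp measurable_prodMk_left))
      (fun x => by simpa using hqQ i (Function.update x i ω)) hω (hE i ω)
    simpa [div_eq_mul_inv] using this
  have hEY2 : ∫⁻ x, Y x ^ 2 ∂P ≤ L * N + N ^ 2 := by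
    refine le_trans (lintegral_mono fun x => ?_) (second_moment μ L
      (fun i => (hQ i).min measurable_const) (fun i ω => min_le_right (Q i ω) L))
    exact pow_le_pow_left' (Finset.sum_le_sum fun i _ => min_le_min_right _ (hqQ i x)) 2
  have hm' : ∫⁻ x, Y x ^ ((1:ℝ)/2) ∂P ≤ ENNReal.ofReal (r / 32) :=
    (lintegral_mono fun x => sqrt_mono (Finset.sum_le_sum fun i _ => min_le_left _ _)).trans hm
  set ν := N.toReal with hν
  have hν0 : 0 ≤ ν := ENNReal.toReal_nonneg
  have hNν : N = ENNReal.ofReal ν := (ENNReal.ofReal_toReal hNtop).symm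
  set τ := Real.sqrt (27 * r ^ 2 / (16 * (r ^ 2 + ν))) with hτ
  have hpos : 0 < 16 * (r ^ 2 + ν) := by positivity
  have hτ0 : 0 < τ := Real.sqrt_pos.2 (by positivity)
  have hτ2 : τ ^ 2 * (16 * (r ^ 2 + ν)) = 27 * r ^ 2 := by
    rw [hτ, Real.sq_sqrt (by positivity)]; field_simp
  have hmain : ENNReal.ofReal (τ * r ^ 2) * (N / 2) ≤ ENNReal.ofReal (r ^ 3) * ENNReal.ofReal (r / 32)
      + ENNReal.ofReal (4 / 27 * τ ^ 3) * (L * N + N ^ 2) := by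
    calc _ ≤ ENNReal.ofReal (τ * r ^ 2) * ∫⁻ x, Y x ∂P := by gcongr
      _ = ∫⁻ x, ENNReal.ofReal (τ * r ^ 2) * Y x ∂P := (lintegral_const_mul _ hYm).symm
      _ ≤ ∫⁻ x, (ENNReal.ofReal (r ^ 3) * Y x ^ ((1:ℝ)/2)
            + ENNReal.ofReal (4 / 27 * τ ^ 3) * Y x ^ 2) ∂P :=
          lintegral_mono fun x => enn_poly hr hτ0 (hYtop x)
      _ = ENNReal.ofReal (r ^ 3) * ∫⁻ x, Y x ^ ((1:ℝ)/2) ∂P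
            + ENNReal.ofReal (4 / 27 * τ ^ 3) * ∫⁻ x, Y x ^ 2 ∂P := by
          rw [lintegral_add_left ((hYm.pow_const _).const_mul _),
            lintegral_const_mul _ (hYm.pow_const _), lintegral_const_mul _ (hYm.pow_const _)]
      _ ≤ _ := by gcongr
  have h2 : ENNReal.ofReal ν / 2 = ENNReal.ofReal (ν / 2) := by
    rw [ENNReal.ofReal_div_of_pos (by norm_num), ENNReal.ofReal_ofNat]
  rw [hL, hNν, h2, ← ENNReal.ofReal_pow hν0, ← ENNReal.ofReal_mul (by positivity),
    ← ENNReal.ofReal_mul (by positivity), ← ENNReal.ofReal_mul (by positivity),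
    ← ENNReal.ofReal_add (by positivity) (by positivity), ← ENNReal.ofReal_mul (by positivity),
    ← ENNReal.ofReal_add (by positivity) (by positivity),
    ENNReal.ofReal_le_ofReal_iff (by positivity)] at hmain
  rw [hNν]
  exact ENNReal.ofReal_le_ofReal (real_core hr hν0 hτ0 hτ2 hmain)

theorem large_pt {X : Type*} [MeasurableSpace X] (P : Measure X) [IsProbabilityMeasure P]
    {q : X → ℝ≥0∞} (hq : Measurable q) {Q : ℝ≥0∞} (hqQ : ∀ x, q x ≤ Q) (hQ : Q ≠ ⊤)
    (h : Q / 2 ≤ ∫⁻ x, q x ∂P) {B : Set X} (hB : MeasurableSet B) (hPB : P Bᶜ ≤ 1 / 4) :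
    Q ^ ((1:ℝ)/2) ≤ 4 * ∫⁻ x, B.indicator (fun x => q x ^ ((1:ℝ)/2)) x ∂P := by
  set I := ∫⁻ x, B.indicator (fun x => q x ^ ((1:ℝ)/2)) x ∂P with hI
  rcases eq_or_ne Q 0 with h0 | h0
  · simp [h0]
  set w := Q ^ ((1:ℝ)/2) with hw
  have hwQ : w ^ 2 = Q := sqrt_sq Q
  have hw0 : w ≠ 0 := by intro h1; rw [h1] at hwQ; simp at hwQ; exact h0 hwQ.symm
  have hwt : w ≠ ⊤ := ENNReal.rpow_ne_top_of_nonneg (by norm_num) hQ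
  have h1 : ∫⁻ x, q x ∂P ≤ w * I + Q * (1 / 4) := by
    calc ∫⁻ x, q x ∂P ≤ ∫⁻ x, (w * B.indicator (fun x => q x ^ ((1:ℝ)/2)) x
            + Bᶜ.indicator (fun _ => Q) x) ∂P := by
          refine lintegral_mono fun x => ?_
          by_cases hx : x ∈ B
          · simp only [hx, Set.indicator_of_mem, Set.mem_compl_iff, not_true_eq_false,
              not_false_eq_true, Set.indicator_of_notMem, add_zero]
            calc q x = (q x ^ ((1:ℝ)/2)) ^ 2 := (sqrt_sq _).symm
              _ = q x ^ ((1:ℝ)/2) * q x ^ ((1:ℝ)/2) := sq _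
              _ ≤ _ := by gcongr; exact sqrt_mono (hqQ x)
          · simp [hx, hqQ x]
      _ = w * I + Q * P Bᶜ := by
          rw [lintegral_add_left (((hq.pow_const _).indicator hB).const_mul _),
            lintegral_const_mul _ ((hq.pow_const _).indicator hB), lintegral_indicator hB.compl,
            setLIntegral_const]
      _ ≤ _ := by gcongr
  have h2 := h.trans h1
  have h3 : Q * (1/4) + Q * (1/4) ≤ w * I + Q * (1/4) := by
    refine le_trans (le_of_eq ?_) h2
    rw [← mul_add, div_eq_mul_inv]
    congr 1
    rw [← ENNReal.toReal_eq_toReal_iff' (by simp) (by simp), ENNReal.toReal_add (by simp) (by simp)]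
    simp
    norm_num
  have h4 : Q * (1/4) ≤ w * I := by
    refine (ENNReal.add_le_add_iff_right ?_).1 h3
    exact ENNReal.mul_ne_top hQ (by simp)
  have h5 : w * w ≤ w * (4 * I) := by
    calc w * w = 4 * (Q * (1/4)) := by
          rw [← sq, hwQ, mul_comm Q, ← mul_assoc, ENNReal.mul_div_cancel (by simp) (by simp), one_mul]
      _ ≤ 4 * (w * I) := by gcongr
      _ = _ := by ring
  exact (ENNReal.mul_le_mul_iff_right hw0 hwt).1 h5

theorem lemA2 (μ : Measure Ω) [IsProbabilityMeasure μ] {n : ℕ}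
    {q : Fin n → (Fin n → Ω) → ℝ≥0∞} {Q : Fin n → Ω → ℝ≥0∞}
    (hq : ∀ i, Measurable (q i)) (hQ : ∀ i, Measurable (Q i))
    (hqQ : ∀ i x, q i x ≤ Q i (x i)) (hfin : ∀ i, ∀ᵐ ω ∂μ, Q i ω ≠ ⊤)
    (hE : ∀ i ω, Q i ω / 2 ≤ ∫⁻ x, q i (Function.update x i ω) ∂(Measure.pi fun _ => μ))
    {L : ℝ≥0∞} (hprob : ∑ i, μ {ω | L < Q i ω} ≤ 1 / 4) :
    ∑ i, ∫⁻ ω in {ω | L < Q i ω}, Q i ω ^ ((1:ℝ)/2) ∂μ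
      ≤ 4 * ∫⁻ x, (∑ i, q i x) ^ ((1:ℝ)/2) ∂(Measure.pi fun _ => μ) := by
  set P : Measure (Fin n → Ω) := Measure.pi fun _ => μ with hP
  set A : Fin n → Set Ω := fun i => {ω | L < Q i ω} with hA
  have hAm : ∀ i, MeasurableSet (A i) := fun i => measurableSet_lt measurable_const (hQ i)
  set D : Fin n → Set (Fin n → Ω) := fun i => {x | ∀ j, j ≠ i → x j ∉ A j} with hD
  have hDm : ∀ i, MeasurableSet (D i) := by
    intro i
    have : D i = ⋂ j, ⋂ (_ : j ≠ i), (fun x : Fin n → Ω => x j) ⁻¹' (A j)ᶜ := by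
      ext x; simp [hD]
    rw [this]
    exact MeasurableSet.iInter fun j => MeasurableSet.iInter fun _ =>
      measurable_pi_apply j (hAm j).compl
  have hPD : ∀ i, P (D i)ᶜ ≤ 1 / 4 := by
    intro i
    refine le_trans ?_ hprob
    have hsub : (D i)ᶜ ⊆ ⋃ j, (fun x : Fin n → Ω => x j) ⁻¹' (A j) := by
      intro x hx
      simp only [hD, Set.mem_compl_iff, Set.mem_ofPred_eq, not_forall] at hx
      obtain ⟨j, hj, hx⟩ := hx
      exact Set.mem_iUnion.2 ⟨j, by simpa using hx⟩
    refine (measure_mono hsub).trans ((measure_iUnion_fintype_le _ _).trans ?_)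
    refine Finset.sum_le_sum fun j _ => le_of_eq ?_
    exact (measurePreserving_eval (fun _ : Fin n => μ) j).measure_preimage
      (hAm j).nullMeasurableSet
  have hDu : ∀ i ω (x : Fin n → Ω), Function.update x i ω ∈ D i ↔ x ∈ D i := by
    intro i ω x
    simp only [hD, Set.mem_ofPred_eq]
    refine forall_congr' fun j => ?_
    refine imp_congr_right fun hj => ?_
    simp [hj]
  set T : Fin n → Set (Fin n → Ω) := fun i => {x | x i ∈ A i} ∩ D i with hT
  have hTm : ∀ i, MeasurableSet (T i) := fun i => (measurable_pi_apply i (hAm i)).inter (hDm i)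
  have hqs : ∀ i, Measurable fun x => q i x ^ ((1:ℝ)/2) := fun i => (hq i).pow_const _
  have hone : ∀ i, ∫⁻ ω in A i, Q i ω ^ ((1:ℝ)/2) ∂μ
      ≤ 4 * ∫⁻ x, (T i).indicator (fun x => q i x ^ ((1:ℝ)/2)) x ∂P := by
    intro i
    rw [← lintegral_indicator (hAm i), ← lintegral_update μ i ((hqs i).indicator (hTm i)),
      ← lintegral_const_mul]
    · refine lintegral_mono_ae ((hfin i).mono fun ω hω => ?_)
      by_cases hωA : ω ∈ A i
      · rw [Set.indicator_of_mem hωA]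
        have := large_pt P (q := fun x => q i (Function.update x i ω))
          ((hq i).comp ((mp_update μ i).measurable.comp measurable_prodMk_left))
          (fun x => by simpa using hqQ i (Function.update x i ω)) hω (hE i ω) (hDm i) (hPD i)
        refine this.trans (le_of_eq ?_)
        congr 1
        refine lintegral_congr fun x => ?_
        by_cases hx : x ∈ D i
        · have : Function.update x i ω ∈ T i := ⟨by simpa using hωA, (hDu i ω x).2 hx⟩
          simp [hx, this]
        · have : Function.update x i ω ∉ T i := fun h => hx ((hDu i ω x).1 h.2)
          simp [hx, this]
      · rw [Set.indicator_of_notMem hωA]; exact bot_le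
    · exact Measurable.lintegral_prod_right'
        (((hqs i).indicator (hTm i)).comp (mp_update μ i).measurable)
  calc _ ≤ ∑ i, 4 * ∫⁻ x, (T i).indicator (fun x => q i x ^ ((1:ℝ)/2)) x ∂P :=
        Finset.sum_le_sum fun i _ => hone i
    _ = 4 * ∫⁻ x, ∑ i, (T i).indicator (fun x => q i x ^ ((1:ℝ)/2)) x ∂P := by
        rw [← Finset.mul_sum, lintegral_finsetSum _ fun i _ => (hqs i).indicator (hTm i)]
    _ ≤ _ := by
        gcongr with x
        by_cases hx : ∃ i, x ∈ T i
        · obtain ⟨i, hi⟩ := hx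
          rw [Finset.sum_eq_single_of_mem i (Finset.mem_univ i)]
          · rw [Set.indicator_of_mem hi]
            exact sqrt_mono (Finset.single_le_sum (f := fun i => q i x)
              (fun _ _ => bot_le) (Finset.mem_univ i))
          · intro j _ hj
            refine Set.indicator_of_notMem (fun hxj => ?_) _
            exact hi.2 j hj hxj.1
        · push Not at hx
          rw [Finset.sum_eq_zero fun i _ => Set.indicator_of_notMem (hx i) _]
          exact bot_le

theorem lemA (μ : Measure Ω) [IsProbabilityMeasure μ] {n : ℕ}
    {q : Fin n → (Fin n → Ω) → ℝ≥0∞} {Q : Fin n → Ω → ℝ≥0∞}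
    (hq : ∀ i, Measurable (q i)) (hQ : ∀ i, Measurable (Q i))
    (hqQ : ∀ i x, q i x ≤ Q i (x i)) (hfin : ∀ i, ∀ᵐ ω ∂μ, Q i ω ≠ ⊤)
    (hE : ∀ i ω, Q i ω / 2 ≤ ∫⁻ x, q i (Function.update x i ω) ∂(Measure.pi fun _ => μ))
    {r : ℝ} (hr : 0 < r)
    (hm : ∫⁻ x, (∑ i, q i x) ^ ((1:ℝ)/2) ∂(Measure.pi fun _ => μ) ≤ ENNReal.ofReal (r / 32)) :
    ∑ i, ∫⁻ ω in {ω | ENNReal.ofReal (r ^ 2) < Q i ω}, Q i ω ^ ((1:ℝ)/2) ∂μ ≤ ENNReal.ofReal r ∧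
    ∑ i, ∫⁻ ω in {ω | ENNReal.ofReal (r ^ 2) < Q i ω}ᶜ, Q i ω ∂μ ≤ ENNReal.ofReal (r ^ 2) := by
  have h1 := lemA1 μ hq hQ hqQ hfin hE hr hm
  set L := ENNReal.ofReal (r ^ 2) with hL
  have hL0 : L ≠ 0 := by simp [hL]; positivity
  have hLt : L ≠ ⊤ := ENNReal.ofReal_ne_top
  have hAm : ∀ i, MeasurableSet {ω | L < Q i ω} := fun i => measurableSet_lt measurable_const (hQ i)
  have hL8 : ENNReal.ofReal (r ^ 2 / 8) = L / 8 := by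
    rw [ENNReal.ofReal_div_of_pos (by norm_num), ENNReal.ofReal_ofNat]
  constructor
  · refine (lemA2 μ hq hQ hqQ hfin hE (L := L) ?_).trans ?_
    · have : L * ∑ i, μ {ω | L < Q i ω} ≤ L * (1 / 4) := by
        calc L * ∑ i, μ {ω | L < Q i ω} ≤ ∑ i, ∫⁻ ω, min (Q i ω) L ∂μ := by
              rw [Finset.mul_sum]
              refine Finset.sum_le_sum fun i _ => ?_
              rw [← setLIntegral_const]
              refine le_trans (setLIntegral_mono' (hAm i) fun ω hω => ?_) (setLIntegral_le_lintegral _ _)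
              exact le_min (le_of_lt hω) le_rfl
          _ ≤ L / 8 := by rw [← hL8]; exact h1
          _ ≤ L * (1 / 4) := by
              rw [div_eq_mul_inv, one_div]; gcongr; norm_num
      exact (ENNReal.mul_le_mul_iff_right hL0 hLt).1 this
    · refine (mul_le_mul_right hm 4).trans ?_
      rw [show (4:ℝ≥0∞) = ENNReal.ofReal 4 by simp, ← ENNReal.ofReal_mul (by norm_num)]
      exact ENNReal.ofReal_le_ofReal (by linarith)
  · refine le_trans (Finset.sum_le_sum fun i _ => ?_) (h1.trans (ENNReal.ofReal_le_ofReal ?_))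
    · refine le_trans (setLIntegral_mono' (hAm i).compl fun ω hω => ?_) (setLIntegral_le_lintegral _ _)
      exact le_min le_rfl (by simpa using hω)
    · nlinarith [sq_nonneg r]

end KCl

namespace KCl

theorem var_bound (μ : Measure Ω) [IsProbabilityMeasure μ] {n : ℕ}
    {X : Fin n → Ω → ℝ} (hX : ∀ i, Measurable (X i)) :
    ∫⁻ x : Fin n → Ω, ‖∑ i, (X i (x i) - ∫ ω, X i ω ∂μ)‖ₑ ^ 2 ∂(Measure.pi fun _ => μ)
      ≤ ∑ i, ∫⁻ ω, ‖X i ω‖ₑ ^ 2 ∂μ := by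
  by_cases hfin : ∀ i, ∫⁻ ω, ‖X i ω‖ₑ ^ 2 ∂μ < ⊤
  · have hL : ∀ i, MemLp (X i) 2 μ := by
      intro i
      refine ⟨(hX i).aestronglyMeasurable, ?_⟩
      rw [eLpNorm_lt_top_iff_lintegral_rpow_enorm_lt_top (by norm_num) (by norm_num)]
      simpa using hfin i
    have hLi : ∀ i, MemLp (fun x : Fin n → Ω => X i (x i)) 2 (Measure.pi fun _ => μ) := fun i =>
      (hL i).comp_measurePreserving (measurePreserving_eval (fun _ : Fin n => μ) i)
    have hmean : ∫ x : Fin n → Ω, (∑ i, fun x : Fin n → Ω => X i (x i)) x ∂(Measure.pi fun _ => μ)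
        = ∑ i, ∫ ω, X i ω ∂μ := by
      simp only [Finset.sum_apply]
      rw [integral_finsetSum _ fun i _ => (hLi i).integrable (by norm_num)]
      refine Finset.sum_congr rfl fun i _ => ?_
      exact integral_comp_eval (μ := fun _ : Fin n => μ) (hX i).aestronglyMeasurable
    have hv := ProbabilityTheory.variance_sum_pi (μ := fun _ : Fin n => μ) hL
    have hML : MemLp (∑ i, fun x : Fin n → Ω => X i (x i)) 2 (Measure.pi fun _ => μ) :=
      memLp_finsetSum' _ fun i _ => hLi i
    have he := ProbabilityTheory.ofReal_variance hML
    have e1 : ∫⁻ x : Fin n → Ω, ‖∑ i, (X i (x i) - ∫ ω, X i ω ∂μ)‖ₑ ^ 2 ∂(Measure.pi fun _ => μ)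
        = ProbabilityTheory.evariance (∑ i, fun x : Fin n → Ω => X i (x i)) (Measure.pi fun _ => μ) := by
      unfold ProbabilityTheory.evariance
      rw [hmean]
      refine lintegral_congr fun x => ?_
      rw [Finset.sum_sub_distrib, Finset.sum_apply]
    rw [e1, ← he, hv, ENNReal.ofReal_sum_of_nonneg fun i _ => ProbabilityTheory.variance_nonneg _ _]
    refine Finset.sum_le_sum fun i _ => ?_
    refine (ENNReal.ofReal_le_ofReal
      (ProbabilityTheory.variance_le_expectation_sq (hX i).aestronglyMeasurable)).trans ?_
    change ENNReal.ofReal (∫ x, X i x ^ 2 ∂μ) ≤ _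
    rw [ofReal_integral_eq_lintegral_ofReal ((hL i).integrable_sq) (ae_of_all _ fun ω => sq_nonneg _)]
    refine lintegral_mono fun ω => le_of_eq ?_
    rw [Real.enorm_eq_ofReal_abs, ← ENNReal.ofReal_pow (abs_nonneg _), sq_abs]
  · push Not at hfin
    obtain ⟨i, hi⟩ := hfin
    have : ∑ i, ∫⁻ ω, ‖X i ω‖ₑ ^ 2 ∂μ = ⊤ := by
      rw [ENNReal.sum_eq_top]
      exact ⟨i, Finset.mem_univ _, top_le_iff.1 hi⟩
    rw [this]; exact le_top

section
variable {R : Type*} [MeasurableSpace R]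

theorem measurable_mean (μ : Measure Ω) [IsProbabilityMeasure μ] {h : Ω → R → ℝ}
    (hh : Measurable (Function.uncurry h)) : Measurable fun s => ∫ ω, h ω s ∂μ :=
  (hh.stronglyMeasurable.integral_prod_left' (μ := μ)).measurable

theorem measurable_centered (μ : Measure Ω) [IsProbabilityMeasure μ] {n : ℕ}
    {h : Fin n → Ω → R → ℝ} (hh : ∀ i, Measurable (Function.uncurry (h i))) :
    Measurable (Function.uncurry fun (x : Fin n → Ω) (s : R) =>
      ∑ i, (h i (x i) s - ∫ ω, h i ω s ∂μ)) := by
  refine Finset.measurable_fun_sum _ fun i _ => Measurable.sub ?_ ?_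
  · exact (hh i).comp (f := fun z : (Fin n → Ω) × R => (z.1 i, z.2)) (by fun_prop)
  · exact (measurable_mean μ (hh i)).comp measurable_snd

theorem small_bound (μ : Measure Ω) [IsProbabilityMeasure μ] (ν : Measure R) [SFinite ν] {n : ℕ}
    {h : Fin n → Ω → R → ℝ} (hh : ∀ i, Measurable (Function.uncurry (h i))) :
    ∫⁻ x : Fin n → Ω, l2 ν (fun s => ‖∑ i, (h i (x i) s - ∫ ω, h i ω s ∂μ)‖ₑ)
        ∂(Measure.pi fun _ => μ)
      ≤ (∑ i, ∫⁻ ω, ∫⁻ s, ‖h i ω s‖ₑ ^ 2 ∂ν ∂μ) ^ ((1:ℝ)/2) := by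
  set P : Measure (Fin n → Ω) := Measure.pi fun _ => μ
  set W : (Fin n → Ω) → R → ℝ≥0∞ := fun x s => ‖∑ i, (h i (x i) s - ∫ ω, h i ω s ∂μ)‖ₑ with hW
  have hWm : Measurable (Function.uncurry W) := (measurable_centered μ hh).enorm
  have h1 : ∫⁻ x, l2 ν (W x) ∂P ≤ l2 P fun x => l2 ν (W x) := by
    have := cauchy_schwarz (ν := P) (measurable_l2 (ν := ν) hWm) (ψ := fun _ => 1) measurable_const
    simpa [l2] using this
  refine h1.trans ?_
  unfold l2
  apply sqrt_mono
  simp_rw [sqrt_sq]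
  rw [lintegral_lintegral_swap (hWm.pow_const 2).aemeasurable]
  calc ∫⁻ s, ∫⁻ x, W x s ^ 2 ∂P ∂ν ≤ ∫⁻ s, ∑ i, ∫⁻ ω, ‖h i ω s‖ₑ ^ 2 ∂μ ∂ν :=
        lintegral_mono fun s => var_bound μ (X := fun i ω => h i ω s)
          fun i => (hh i).comp measurable_prodMk_right
    _ = ∑ i, ∫⁻ s, ∫⁻ ω, ‖h i ω s‖ₑ ^ 2 ∂μ ∂ν := by
        refine lintegral_finsetSum _ fun i _ => ?_
        exact Measurable.lintegral_prod_left' (f := fun z : Ω × R => ‖h i z.1 z.2‖ₑ ^ 2)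
          ((hh i).enorm.pow_const 2)
    _ = ∑ i, ∫⁻ ω, ∫⁻ s, ‖h i ω s‖ₑ ^ 2 ∂ν ∂μ := by
        refine Finset.sum_congr rfl fun i _ => (lintegral_lintegral_swap ?_).symm
        exact ((hh i).enorm.pow_const 2).aemeasurable

theorem lemB (μ : Measure Ω) [IsProbabilityMeasure μ] (ν : Measure R) [SFinite ν] {n : ℕ}
    {h : Fin n → Ω → R → ℝ} (hh : ∀ i, Measurable (Function.uncurry (h i)))
    (hint : ∀ i, ∀ᵐ s ∂ν, Integrable (fun ω => h i ω s) μ)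
    {A : Fin n → Set Ω} (hA : ∀ i, MeasurableSet (A i)) :
    ∫⁻ x : Fin n → Ω, l2 ν (fun s => ‖∑ i, (h i (x i) s - ∫ ω, h i ω s ∂μ)‖ₑ)
        ∂(Measure.pi fun _ => μ)
      ≤ 2 * ∑ i, ∫⁻ ω in A i, (∫⁻ s, ‖h i ω s‖ₑ ^ 2 ∂ν) ^ ((1:ℝ)/2) ∂μ
        + (∑ i, ∫⁻ ω in (A i)ᶜ, ∫⁻ s, ‖h i ω s‖ₑ ^ 2 ∂ν ∂μ) ^ ((1:ℝ)/2) := by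
  set P : Measure (Fin n → Ω) := Measure.pi fun _ => μ
  set hl : Fin n → Ω → R → ℝ := fun i ω s => (A i).indicator (fun ω => h i ω s) ω with hhl
  set hs : Fin n → Ω → R → ℝ := fun i ω s => (A i)ᶜ.indicator (fun ω => h i ω s) ω with hhs
  have hlm : ∀ i, Measurable (Function.uncurry (hl i)) := by
    intro i
    have : Function.uncurry (hl i) = (Prod.fst ⁻¹' (A i)).indicator (Function.uncurry (h i)) := by
      ext z; rfl
    rw [this]
    exact (hh i).indicator (measurable_fst (hA i))
  have hsm : ∀ i, Measurable (Function.uncurry (hs i)) := by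
    intro i
    have : Function.uncurry (hs i) = (Prod.fst ⁻¹' (A i)ᶜ).indicator (Function.uncurry (h i)) := by
      ext z; rfl
    rw [this]
    exact (hh i).indicator (measurable_fst (hA i).compl)
  have hadd : ∀ i ω s, h i ω s = hl i ω s + hs i ω s := by
    intro i ω s
    by_cases hω : ω ∈ A i <;> simp [hhl, hhs, hω]
  have hlx : ∀ i ω, Measurable fun s => ‖hl i ω s‖ₑ := fun i ω =>
    ((hlm i).comp measurable_prodMk_left).enorm
  have hlint : ∀ i, Measurable fun s => ∫⁻ ω, ‖hl i ω s‖ₑ ∂μ := fun i =>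
    Measurable.lintegral_prod_left' (f := fun z : Ω × R => ‖hl i z.1 z.2‖ₑ) (hlm i).enorm
  have hWm := measurable_centered μ hsm
  set W : (Fin n → Ω) → R → ℝ≥0∞ := fun x s => ‖∑ i, (hs i (x i) s - ∫ ω, hs i ω s ∂μ)‖ₑ with hW
  have hWx : ∀ x, Measurable (W x) := fun x => (hWm.comp measurable_prodMk_left).enorm
  have hpt : ∀ᵐ s ∂ν, ∀ x : Fin n → Ω, ‖∑ i, (h i (x i) s - ∫ ω, h i ω s ∂μ)‖ₑ
      ≤ (∑ i, (‖hl i (x i) s‖ₑ + ∫⁻ ω, ‖hl i ω s‖ₑ ∂μ)) + W x s := by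
    filter_upwards [ae_all_iff.2 hint] with s hs' x
    have e : ∑ i, (h i (x i) s - ∫ ω, h i ω s ∂μ)
        = ∑ i, (hl i (x i) s - ∫ ω, hl i ω s ∂μ) + ∑ i, (hs i (x i) s - ∫ ω, hs i ω s ∂μ) := by
      rw [← Finset.sum_add_distrib]
      refine Finset.sum_congr rfl fun i _ => ?_
      have : ∫ ω, h i ω s ∂μ = ∫ ω, hl i ω s ∂μ + ∫ ω, hs i ω s ∂μ := by
        rw [← integral_add]
        · exact integral_congr_ae (ae_of_all _ fun ω => hadd i ω s)
        · exact (hs' i).indicator (hA i)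
        · exact (hs' i).indicator (hA i).compl
      rw [this, hadd i (x i) s]; ring
    rw [e]
    refine (enorm_add_le _ _).trans ?_
    gcongr
    refine (enorm_sum_le _ _).trans (Finset.sum_le_sum fun i _ => ?_)
    refine enorm_sub_le.trans ?_
    gcongr
    exact enorm_integral_le_lintegral_enorm _
  have hl2 : ∀ i ω, l2 ν (fun s => ‖hl i ω s‖ₑ)
      = (A i).indicator (fun ω => (∫⁻ s, ‖h i ω s‖ₑ ^ 2 ∂ν) ^ ((1:ℝ)/2)) ω := by
    intro i ω
    by_cases hω : ω ∈ A i <;> simp [hhl, hω, l2]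
  have hl2m : ∀ i, Measurable fun ω => l2 ν (fun s => ‖hl i ω s‖ₑ) := fun i =>
    measurable_l2 (φ := fun ω s => ‖hl i ω s‖ₑ) (hlm i).enorm
  have hI : ∀ i, ∫⁻ ω, l2 ν (fun s => ‖hl i ω s‖ₑ) ∂μ
      = ∫⁻ ω in A i, (∫⁻ s, ‖h i ω s‖ₑ ^ 2 ∂ν) ^ ((1:ℝ)/2) ∂μ := by
    intro i
    rw [← lintegral_indicator (hA i)]
    exact lintegral_congr fun ω => hl2 i ω
  have hx2 : ∀ x : Fin n → Ω, l2 ν (fun s => ‖∑ i, (h i (x i) s - ∫ ω, h i ω s ∂μ)‖ₑ)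
      ≤ ∑ i, (l2 ν (fun s => ‖hl i (x i) s‖ₑ)
          + ∫⁻ ω, l2 ν (fun s => ‖hl i ω s‖ₑ) ∂μ) + l2 ν (W x) := by
    intro x
    refine (l2_mono_ae (hpt.mono fun s hs => hs x)).trans ?_
    refine (l2_add_le (Finset.measurable_fun_sum _ fun i _ => (hlx i (x i)).add (hlint i))
      (hWx x)).trans ?_
    gcongr
    refine (l2_sum_le _ fun i => (hlx i (x i)).add (hlint i)).trans ?_
    refine Finset.sum_le_sum fun i _ => ?_
    refine (l2_add_le (hlx i (x i)) (hlint i)).trans ?_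
    gcongr
    exact minkowski μ (φ := fun ω s => ‖hl i ω s‖ₑ) (hlm i).enorm
  have hmx : ∀ i, Measurable fun x : Fin n → Ω => l2 ν (fun s => ‖hl i (x i) s‖ₑ) := fun i =>
    (hl2m i).comp (measurable_pi_apply i)
  calc _ ≤ ∫⁻ x : Fin n → Ω, (∑ i, (l2 ν (fun s => ‖hl i (x i) s‖ₑ)
          + ∫⁻ ω, l2 ν (fun s => ‖hl i ω s‖ₑ) ∂μ) + l2 ν (W x)) ∂P := lintegral_mono hx2
    _ = ∑ i, (∫⁻ ω, l2 ν (fun s => ‖hl i ω s‖ₑ) ∂μ + ∫⁻ ω, l2 ν (fun s => ‖hl i ω s‖ₑ) ∂μ)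
          + ∫⁻ x, l2 ν (W x) ∂P := by
        have hmm : ∀ i, Measurable fun x : Fin n → Ω => l2 ν (fun s => ‖hl i (x i) s‖ₑ)
            + ∫⁻ ω, l2 ν (fun s => ‖hl i ω s‖ₑ) ∂μ := fun i => (hmx i).add measurable_const
        rw [lintegral_add_left (Finset.measurable_fun_sum _ fun i _ => hmm i),
          lintegral_finsetSum _ fun i _ => hmm i]
        congr 1
        refine Finset.sum_congr rfl fun i _ => ?_
        rw [lintegral_add_left (hmx i), lintegral_const, measure_univ, mul_one,
          lintegral_eval μ i (hl2m i)]
    _ ≤ _ := by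
        simp_rw [hI]
        rw [Finset.mul_sum]
        simp_rw [two_mul]
        gcongr
        refine (small_bound μ ν hsm).trans (sqrt_mono (Finset.sum_le_sum fun i _ => ?_))
        rw [← lintegral_indicator (hA i).compl]
        refine lintegral_mono fun ω => ?_
        by_cases hω : ω ∈ A i <;> simp [hhs, hω]

/-- Key estimate: a conditional lower bound implies control of the centered sums. -/
theorem lemAB (μ : Measure Ω) [IsProbabilityMeasure μ] (ν : Measure R) [SigmaFinite ν] {n : ℕ}
    {h : Fin n → Ω → R → ℝ} (hh : ∀ i, Measurable (Function.uncurry (h i)))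
    {c : (Fin n → Ω) → R → ℝ≥0∞} (hc : Measurable (Function.uncurry c))
    {Z : Set ((Fin n → Ω) × R)} (hZ : MeasurableSet Z)
    (H1 : ∀ x s, (x, s) ∈ Z → ∑ i, ‖h i (x i) s‖ₑ ^ 2 ≤ (2 * c x s) ^ 2)
    (H2 : ∀ i ω s, h i ω s ≠ 0 →
      1 / 2 ≤ (Measure.pi fun _ => μ) {x : Fin n → Ω | (Function.update x i ω, s) ∈ Z})
    (hfin : ∫⁻ x, l2 ν (c x) ∂(Measure.pi fun _ => μ) ≠ ⊤) :
    (∀ i, ∫⁻ ω, l2 ν (fun s => ‖h i ω s‖ₑ) ∂μ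
      ≤ 4 * ∫⁻ x, l2 ν (c x) ∂(Measure.pi fun _ => μ)) ∧
    (∀ i, ∀ᵐ s ∂ν, Integrable (fun ω => h i ω s) μ) ∧
    ∫⁻ x : Fin n → Ω, l2 ν (fun s => ‖∑ i, (h i (x i) s - ∫ ω, h i ω s ∂μ)‖ₑ)
        ∂(Measure.pi fun _ => μ)
      ≤ 192 * ∫⁻ x, l2 ν (c x) ∂(Measure.pi fun _ => μ) := by
  set P : Measure (Fin n → Ω) := Measure.pi fun _ => μ with hP
  have hupd : ∀ i ω, Measurable fun x : Fin n → Ω => Function.update x i ω := fun i ω =>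
    (mp_update μ i).measurable.comp measurable_prodMk_left
  have hZs : ∀ i ω s, MeasurableSet {x : Fin n → Ω | (Function.update x i ω, s) ∈ Z} := fun i ω s =>
    ((hupd i ω).prodMk measurable_const) hZ
  have hhx : ∀ i ω, Measurable fun s => ‖h i ω s‖ₑ := fun i ω =>
    ((hh i).comp measurable_prodMk_left).enorm
  have hh2 : ∀ i, Measurable fun ω => l2 ν (fun s => ‖h i ω s‖ₑ) := fun i =>
    measurable_l2 (φ := fun ω s => ‖h i ω s‖ₑ) (hh i).enorm
  -- a priori bound
  have hap : ∀ i ω s, ‖h i ω s‖ₑ ≤ 4 * ∫⁻ x, c (Function.update x i ω) s ∂P := by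
    intro i ω s
    by_cases h0 : h i ω s = 0
    · simp [h0]
    have h2 := H2 i ω s h0
    have h3 : ‖h i ω s‖ₑ * (1 / 2) ≤ 2 * ∫⁻ x, c (Function.update x i ω) s ∂P := by
      calc ‖h i ω s‖ₑ * (1 / 2)
          ≤ ‖h i ω s‖ₑ * P {x : Fin n → Ω | (Function.update x i ω, s) ∈ Z} := by gcongr
        _ = ∫⁻ x in {x : Fin n → Ω | (Function.update x i ω, s) ∈ Z}, ‖h i ω s‖ₑ ∂P := by
            rw [setLIntegral_const]
        _ ≤ ∫⁻ x in {x : Fin n → Ω | (Function.update x i ω, s) ∈ Z},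
              2 * c (Function.update x i ω) s ∂P := by
            refine setLIntegral_mono' (hZs i ω s) fun x hx => le_of_sq_le ?_
            refine le_trans ?_ (H1 _ _ hx)
            have := Finset.single_le_sum (f := fun j => ‖h j (Function.update x i ω j) s‖ₑ ^ 2)
              (fun _ _ => bot_le) (Finset.mem_univ i)
            simpa using this
        _ ≤ ∫⁻ x, 2 * c (Function.update x i ω) s ∂P := setLIntegral_le_lintegral _ _
        _ = _ := lintegral_const_mul' _ _ (by simp)
    calc ‖h i ω s‖ₑ = 2 * (‖h i ω s‖ₑ * (1 / 2)) := by
          rw [mul_comm, mul_assoc, ENNReal.div_mul_cancel (by simp) (by simp), mul_one]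
      _ ≤ 2 * (2 * ∫⁻ x, c (Function.update x i ω) s ∂P) := by gcongr
      _ = _ := by rw [← mul_assoc]; norm_num
  have hcu : ∀ i, Measurable fun z : (Ω × (Fin n → Ω)) × R =>
      c (Function.update z.1.2 i z.1.1) z.2 := fun i =>
    hc.comp (((mp_update μ i).measurable.comp measurable_fst).prodMk measurable_snd)
  have hcux : ∀ i ω, Measurable (Function.uncurry fun (x : Fin n → Ω) s =>
      c (Function.update x i ω) s) := fun i ω =>
    (hcu i).comp (f := fun z : (Fin n → Ω) × R => ((ω, z.1), z.2)) (by fun_prop)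
  have hl2c : Measurable fun x => l2 ν (c x) := measurable_l2 hc
  have hfirst : ∀ i, ∫⁻ ω, l2 ν (fun s => ‖h i ω s‖ₑ) ∂μ ≤ 4 * ∫⁻ x, l2 ν (c x) ∂P := by
    intro i
    rw [← lintegral_update μ i hl2c, ← lintegral_const_mul' _ _ (by simp)]
    refine lintegral_mono fun ω => ?_
    refine (l2_mono (hap i ω)).trans ?_
    rw [l2_const_mul]
    · gcongr
      exact minkowski P (hcux i ω)
    · exact Measurable.lintegral_prod_left' (hcux i ω)
  have hsecond : ∀ i, ∀ᵐ s ∂ν, Integrable (fun ω => h i ω s) μ := by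
    intro i
    have h1 : l2 ν (fun s => ∫⁻ ω, ‖h i ω s‖ₑ ∂μ) < ⊤ :=
      ((minkowski μ (φ := fun ω s => ‖h i ω s‖ₑ) (hh i).enorm).trans (hfirst i)).trans_lt
        (ENNReal.mul_lt_top (by simp) hfin.lt_top)
    have h2 : ∫⁻ s, (∫⁻ ω, ‖h i ω s‖ₑ ∂μ) ^ 2 ∂ν ≠ ⊤ := by
      rw [← l2_sq]; exact ENNReal.pow_ne_top h1.ne
    have hm : Measurable fun s => ∫⁻ ω, ‖h i ω s‖ₑ ∂μ :=
      Measurable.lintegral_prod_left' (f := fun z : Ω × R => ‖h i z.1 z.2‖ₑ) (hh i).enorm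
    filter_upwards [ae_lt_top (hm.pow_const 2) h2] with s hs
    refine ⟨((hh i).comp measurable_prodMk_right).aestronglyMeasurable, ?_⟩
    exact (ENNReal.pow_lt_top_iff.1 hs).resolve_right (by norm_num)
  refine ⟨hfirst, hsecond, ?_⟩
  -- main bound
  set q : Fin n → (Fin n → Ω) → ℝ≥0∞ := fun i x =>
    ∫⁻ s, Z.indicator (fun z => ‖h i (z.1 i) z.2‖ₑ ^ 2) (x, s) ∂ν with hq
  set Q : Fin n → Ω → ℝ≥0∞ := fun i ω => ∫⁻ s, ‖h i ω s‖ₑ ^ 2 ∂ν with hQ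
  have hqm0 : ∀ i, Measurable (Z.indicator (fun z : (Fin n → Ω) × R => ‖h i (z.1 i) z.2‖ₑ ^ 2)) := by
    intro i
    refine Measurable.indicator ?_ hZ
    exact ((hh i).comp (f := fun z : (Fin n → Ω) × R => (z.1 i, z.2)) (by fun_prop)).enorm.pow_const 2
  have hqm : ∀ i, Measurable (q i) := fun i => Measurable.lintegral_prod_right' (hqm0 i)
  have hQm : ∀ i, Measurable (Q i) := fun i =>
    Measurable.lintegral_prod_right' (f := fun z : Ω × R => ‖h i z.1 z.2‖ₑ ^ 2)
      ((hh i).enorm.pow_const 2)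
  have hqQ : ∀ i x, q i x ≤ Q i (x i) := fun i x =>
    lintegral_mono fun s => Set.indicator_le_self _ _ _
  have hQfin : ∀ i, ∀ᵐ ω ∂μ, Q i ω ≠ ⊤ := by
    intro i
    have := ae_lt_top (hh2 i) ((hfirst i).trans_lt (ENNReal.mul_lt_top (by simp) hfin.lt_top)).ne
    filter_upwards [this] with ω hω
    rw [hQ]; dsimp only
    rw [← l2_sq]; exact ENNReal.pow_ne_top hω.ne
  have hE : ∀ i ω, Q i ω / 2 ≤ ∫⁻ x, q i (Function.update x i ω) ∂P := by
    intro i ω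
    rw [hq]; dsimp only
    rw [lintegral_lintegral_swap]
    · rw [div_eq_mul_inv, ← lintegral_mul_const _ ((hhx i ω).pow_const 2)]
      refine lintegral_mono fun s => ?_
      have : ∀ x : Fin n → Ω, Z.indicator (fun z : (Fin n → Ω) × R => ‖h i (z.1 i) z.2‖ₑ ^ 2)
          (Function.update x i ω, s) = {x : Fin n → Ω | (Function.update x i ω, s) ∈ Z}.indicator
            (fun _ => ‖h i ω s‖ₑ ^ 2) x := by
        intro x
        by_cases hx : (Function.update x i ω, s) ∈ Z <;> simp [hx]
      simp_rw [this]
      rw [lintegral_indicator (hZs i ω s), setLIntegral_const]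
      by_cases h0 : h i ω s = 0
      · simp [h0]
      · gcongr
        simpa using H2 i ω s h0
    · exact ((hqm0 i).comp (((hupd i ω).comp measurable_fst).prodMk measurable_snd)).aemeasurable
  have hqsum : ∀ x, (∑ i, q i x) ^ ((1:ℝ)/2) ≤ 2 * l2 ν (c x) := by
    intro x
    have hcx : Measurable (c x) := hc.comp measurable_prodMk_left
    rw [← l2_const_mul 2 hcx]
    apply sqrt_mono
    rw [hq]; dsimp only
    have hqs : ∀ i, Measurable fun s => Z.indicator
        (fun z : (Fin n → Ω) × R => ‖h i (z.1 i) z.2‖ₑ ^ 2) (x, s) := fun i =>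
      (hqm0 i).comp measurable_prodMk_left
    rw [← lintegral_finsetSum _ fun i _ => hqs i]
    refine lintegral_mono fun s => ?_
    by_cases hx : (x, s) ∈ Z
    · simpa [hx] using H1 x s hx
    · simp [hx]
  set m := ∫⁻ x, l2 ν (c x) ∂P with hm
  have hqm2 : ∫⁻ x, (∑ i, q i x) ^ ((1:ℝ)/2) ∂P ≤ 2 * m := by
    rw [hm, ← lintegral_const_mul' _ _ (by simp)]
    exact lintegral_mono hqsum
  have hr : ∀ r : ℝ, 0 < r → 2 * m ≤ ENNReal.ofReal (r / 32) →
      ∫⁻ x : Fin n → Ω, l2 ν (fun s => ‖∑ i, (h i (x i) s - ∫ ω, h i ω s ∂μ)‖ₑ) ∂P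
        ≤ ENNReal.ofReal (3 * r) := by
    intro r hr hmr
    obtain ⟨a1, a2⟩ := lemA μ hqm hQm hqQ hQfin hE hr (hqm2.trans hmr)
    refine (lemB μ ν hh hsecond (A := fun i => {ω | ENNReal.ofReal (r ^ 2) < Q i ω})
      fun i => measurableSet_lt measurable_const (hQm i)).trans ?_
    have a3 := sqrt_mono a2
    rw [ENNReal.ofReal_pow hr.le, sq_sqrt] at a3
    rw [show 3 * r = 2 * r + r by ring, ENNReal.ofReal_add (by positivity) hr.le,
      ENNReal.ofReal_mul (by norm_num), ENNReal.ofReal_ofNat]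
    rw [← ENNReal.ofReal_pow hr.le] at a3
    gcongr
  refine ENNReal.le_of_forall_pos_le_add fun ε hε _ => ?_
  have hmt : m = ENNReal.ofReal m.toReal := (ENNReal.ofReal_toReal hfin).symm
  have hm0 : 0 ≤ m.toReal := ENNReal.toReal_nonneg
  have hε' : (0:ℝ) < ε := hε
  refine (hr (64 * m.toReal + ε / 3) (by positivity) ?_).trans ?_
  · rw [hmt, show (2:ℝ≥0∞) = ENNReal.ofReal 2 by simp, ← ENNReal.ofReal_mul (by norm_num)]
    refine ENNReal.ofReal_le_ofReal ?_
    simp only [ENNReal.toReal_ofReal hm0]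
    linarith
  · rw [show 3 * (64 * m.toReal + ε / 3) = 192 * m.toReal + ε by ring,
      ENNReal.ofReal_add (by positivity) hε'.le, ENNReal.ofReal_mul (by norm_num), ← hmt]
    simp

end

end KCl

namespace KCl

theorem measurable_upd {n : ℕ} (i : Fin n) :
    Measurable fun p : Ω × (Fin n → Ω) => Function.update p.2 i p.1 :=
  measurable_update'.comp measurable_swap

theorem ext_scalar (μ : Measure Ω) [IsProbabilityMeasure μ] {n : ℕ}
    {v : (Fin n → Ω) → ℝ} (hv : Measurable v) (hvi : Integrable v (Measure.pi fun _ => μ))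
    {g : Fin n → Ω → ℝ} (hg : ∀ i, Measurable (g i)) (hgi : ∀ i, Integrable (g i) μ)
    (hg0 : ∀ i, ∫ ω, g i ω ∂μ = 0) :
    (∀ i, Integrable (fun ω => ∫ y, v (Function.update y i ω) ∂(Measure.pi fun _ => μ)) μ) ∧
    ∫⁻ x : Fin n → Ω, ‖v x - ∑ i, ∫ y, v (Function.update y i (x i)) ∂(Measure.pi fun _ => μ)‖ₑ
        ∂(Measure.pi fun _ => μ)
      + ∑ i, ‖∫ ω, ∫ y, v (Function.update y i ω) ∂(Measure.pi fun _ => μ) ∂μ‖ₑ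
      ≤ (2 * n + 1) * ∫⁻ x : Fin n → Ω, ‖v x - ∑ i, g i (x i)‖ₑ ∂(Measure.pi fun _ => μ) := by
  set P : Measure (Fin n → Ω) := Measure.pi fun _ => μ with hP
  set D : (Fin n → Ω) → ℝ := fun x => v x - ∑ i, g i (x i) with hD
  set w : Fin n → Ω → ℝ := fun i ω => ∫ y, v (Function.update y i ω) ∂P with hw
  have hgx : ∀ i, Integrable (fun x : Fin n → Ω => g i (x i)) P := fun i =>
    (measurePreserving_eval (fun _ : Fin n => μ) i).integrable_comp_of_integrable (hgi i)
  have hDm : Measurable D :=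
    hv.sub (Finset.measurable_fun_sum _ fun i _ => (hg i).comp (measurable_pi_apply i))
  have hDi : Integrable D P := hvi.sub (integrable_finsetSum _ fun i _ => hgx i)
  have hwm : ∀ i, Measurable (w i) := fun i =>
    ((hv.comp (measurable_upd i)).stronglyMeasurable.integral_prod_right' (ν := P)).measurable
  have hwi : ∀ i, Integrable (w i) μ := by
    intro i
    have h1 : Integrable (fun p : Ω × (Fin n → Ω) => v (Function.update p.2 i p.1)) (μ.prod P) :=
      (mp_update μ i).integrable_comp_of_integrable hvi
    exact h1.integral_prod_left
  have hae : ∀ i, ∀ᵐ ω ∂μ, w i ω - g i ω = ∫ y, D (Function.update y i ω) ∂P := by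
    intro i
    have h1 : Integrable (fun p : Ω × (Fin n → Ω) => D (Function.update p.2 i p.1)) (μ.prod P) :=
      (mp_update μ i).integrable_comp_of_integrable hDi
    filter_upwards [h1.prod_right_ae] with ω hω
    have h2 : ∀ j, Integrable (fun y : Fin n → Ω => g j (Function.update y i ω j)) P := by
      intro j
      by_cases hj : j = i
      · subst hj; simp
      · simpa [hj] using hgx j
    have h3 : ∀ j, ∫ y : Fin n → Ω, g j (Function.update y i ω j) ∂P = if j = i then g i ω else 0 := by
      intro j
      by_cases hj : j = i
      · subst hj; simp
      · simp only [hj, if_false, ne_eq, not_false_eq_true, Function.update_of_ne]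
        rw [← hg0 j]
        exact integral_comp_eval (μ := fun _ : Fin n => μ) (hg j).aestronglyMeasurable
    have h4 : ∀ y : Fin n → Ω, v (Function.update y i ω)
        = D (Function.update y i ω) + ∑ j, g j (Function.update y i ω j) := by
      intro y; simp [hD]
    rw [hw]; dsimp only
    simp_rw [h4]
    rw [integral_add hω (integrable_finsetSum _ fun j _ => h2 j),
      integral_finsetSum _ fun j _ => h2 j]
    simp_rw [h3]
    simp
  set e := ∫⁻ x, ‖D x‖ₑ ∂P with he
  have hwg : ∀ i, ∫⁻ ω, ‖w i ω - g i ω‖ₑ ∂μ ≤ e := by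
    intro i
    rw [he, ← lintegral_update μ i hDm.enorm]
    refine lintegral_mono_ae ((hae i).mono fun ω hω => ?_)
    rw [hω]
    exact enorm_integral_le_lintegral_enorm _
  refine ⟨hwi, ?_⟩
  have hmd : ∀ i, Measurable fun ω => ‖w i ω - g i ω‖ₑ := fun i => ((hwm i).sub (hg i)).enorm
  have hA : ∫⁻ x : Fin n → Ω, ‖v x - ∑ i, w i (x i)‖ₑ ∂P ≤ e + n * e := by
    calc ∫⁻ x : Fin n → Ω, ‖v x - ∑ i, w i (x i)‖ₑ ∂P
        ≤ ∫⁻ x : Fin n → Ω, (‖D x‖ₑ + ∑ i, ‖w i (x i) - g i (x i)‖ₑ) ∂P := by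
          refine lintegral_mono fun x => ?_
          have : v x - ∑ i, w i (x i) = D x - ∑ i, (w i (x i) - g i (x i)) := by
            rw [Finset.sum_sub_distrib]; simp only [hD]; ring
          rw [this]
          refine enorm_sub_le.trans ?_
          gcongr
          exact enorm_sum_le _ _
      _ = e + ∑ i, ∫⁻ ω, ‖w i ω - g i ω‖ₑ ∂μ := by
          rw [lintegral_add_left hDm.enorm, lintegral_finsetSum]
          · congr 1
            exact Finset.sum_congr rfl fun i _ => lintegral_eval μ i (hmd i)
          · exact fun i _ => (hmd i).comp (measurable_pi_apply i)
      _ ≤ e + ∑ _i : Fin n, e := by gcongr with i; exact hwg i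
      _ = _ := by simp
  have hB : ∑ i, ‖∫ ω, w i ω ∂μ‖ₑ ≤ n * e := by
    calc ∑ i, ‖∫ ω, w i ω ∂μ‖ₑ ≤ ∑ _i : Fin n, e := by
          refine Finset.sum_le_sum fun i _ => ?_
          have : ∫ ω, w i ω ∂μ = ∫ ω, (w i ω - g i ω) ∂μ := by
            rw [integral_sub (hwi i) (hgi i), hg0 i, sub_zero]
          rw [this]
          exact (enorm_integral_le_lintegral_enorm _).trans (hwg i)
      _ = _ := by simp
  calc _ ≤ (e + n * e) + n * e := add_le_add hA hB
    _ = _ := by ring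

theorem extract (μ : Measure Ω) [IsProbabilityMeasure μ] {n : ℕ}
    {N : ((Fin n → Ω) → ℝ → ℝ) → ℝ≥0∞}
    (hdom : ∀ k : ℕ, ∃ C : ℝ≥0∞, C ≠ ⊤ ∧ ∀ G : (Fin n → Ω) → ℝ → ℝ,
      Measurable (Function.uncurry G) →
      ∫⁻ x, ∫⁻ s in Set.Icc (-k : ℝ) k, ‖G x s‖ₑ ∂volume ∂(Measure.pi fun _ => μ) ≤ C * N G)
    {v : (Fin n → Ω) → ℝ → ℝ} (hv : MemV11 μ N v) :
    ∃ f : Fin n → Ω → ℝ → ℝ, (∀ i, Measurable (Function.uncurry (f i))) ∧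
      (∀ i, ∀ᵐ s, Integrable (fun ω => f i ω s) μ ∧ ∫ ω, f i ω s ∂μ = 0) ∧
      ∀ᵐ s, ∀ᵐ x ∂(Measure.pi fun _ : Fin n => μ), v x s = ∑ i, f i (x i) s := by
  obtain ⟨hvm, hvN, happ⟩ := hv
  set P : Measure (Fin n → Ω) := Measure.pi fun _ => μ with hP
  set f : Fin n → Ω → ℝ → ℝ := fun i ω s => ∫ y, v (Function.update y i ω) s ∂P with hf
  have hfm : ∀ i, Measurable (Function.uncurry (f i)) := by
    intro i
    have h1 : Measurable fun z : (Ω × ℝ) × (Fin n → Ω) => v (Function.update z.2 i z.1.1) z.1.2 :=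
      hvm.comp (f := fun z : (Ω × ℝ) × (Fin n → Ω) => (Function.update z.2 i z.1.1, z.1.2))
        (((measurable_upd i).comp (f := fun z : (Ω × ℝ) × (Fin n → Ω) => (z.1.1, z.2))
          (by fun_prop)).prodMk (by fun_prop))
    exact (h1.stronglyMeasurable.integral_prod_right' (ν := P)).measurable
  have hvs : ∀ s, Measurable fun x => v x s := fun s => hvm.comp measurable_prodMk_right
  set E : ℝ → ℝ≥0∞ := fun s => ∫⁻ x : Fin n → Ω, ‖v x s - ∑ i, f i (x i) s‖ₑ ∂P
      + ∑ i, ‖∫ ω, f i ω s ∂μ‖ₑ with hE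
  have hdm : Measurable (Function.uncurry fun (x : Fin n → Ω) s => v x s - ∑ i, f i (x i) s) :=
    hvm.sub (Finset.measurable_fun_sum _ fun i _ =>
      (hfm i).comp (f := fun z : (Fin n → Ω) × ℝ => (z.1 i, z.2)) (by fun_prop))
  have hEm : Measurable E := by
    refine Measurable.add ?_ ?_
    · exact Measurable.lintegral_prod_left' hdm.enorm
    · exact Finset.measurable_fun_sum _ fun i _ => (measurable_mean μ (hfm i)).enorm
  have hswap : ∀ (k : ℕ) {G : (Fin n → Ω) → ℝ → ℝ}, Measurable (Function.uncurry G) →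
      ∫⁻ s in Set.Icc (-k : ℝ) k, ∫⁻ x, ‖G x s‖ₑ ∂P = ∫⁻ x, ∫⁻ s in Set.Icc (-k : ℝ) k, ‖G x s‖ₑ ∂volume ∂P :=
    fun k G hG => (lintegral_lintegral_swap hG.enorm.aemeasurable).symm
  have hcov : ∀ {p : ℝ → Prop}, (∀ k : ℕ, ∀ᵐ s ∂(volume.restrict (Set.Icc (-k : ℝ) k)), p s) →
      ∀ᵐ s, p s := by
    intro p hp
    have : (⋃ k : ℕ, Set.Icc (-k : ℝ) k) = Set.univ := by
      refine Set.eq_univ_of_forall fun s => ?_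
      obtain ⟨k, hk⟩ := exists_nat_ge |s|
      exact Set.mem_iUnion.2 ⟨k, abs_le.1 hk⟩
    have h := (ae_restrict_iUnion_iff (μ := volume) (fun k : ℕ => Set.Icc (-k : ℝ) k) p).2 hp
    rwa [this, Measure.restrict_univ] at h
  have hvint : ∀ᵐ s, Integrable (fun x => v x s) P := by
    refine hcov fun k => ?_
    obtain ⟨C, hC, hk⟩ := hdom k
    have h1 := hk v hvm
    rw [← hswap k hvm] at h1
    have h2 : ∫⁻ s in Set.Icc (-k : ℝ) k, ∫⁻ x, ‖v x s‖ₑ ∂P ≠ ⊤ :=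
      (h1.trans_lt (ENNReal.mul_lt_top hC.lt_top hvN)).ne
    filter_upwards [ae_lt_top (Measurable.lintegral_prod_left' hvm.enorm) h2] with s hs
    exact ⟨(hvs s).aestronglyMeasurable, hs⟩
  have hkey : ∀ ε : ℝ, 0 < ε → ∃ g : Fin n → Ω → ℝ → ℝ,
      Measurable (Function.uncurry fun (x : Fin n → Ω) s => v x s - ∑ i, g i (x i) s) ∧
      N (fun x s => v x s - ∑ i, g i (x i) s) ≤ ENNReal.ofReal ε ∧
      ∀ᵐ s, (∀ i, Integrable (fun ω => f i ω s) μ) ∧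
        E s ≤ (2 * n + 1) * ∫⁻ x, ‖v x s - ∑ i, g i (x i) s‖ₑ ∂P := by
    intro ε hε
    obtain ⟨g, hgm, hg0, -, hgN⟩ := happ ε hε
    refine ⟨g, ?_, hgN, ?_⟩
    · exact hvm.sub (Finset.measurable_fun_sum _ fun i _ =>
        (hgm i).comp (f := fun z : (Fin n → Ω) × ℝ => (z.1 i, z.2)) (by fun_prop))
    · filter_upwards [hvint, ae_all_iff.2 hg0] with s hs hgs
      exact ext_scalar μ (hvs s) hs (g := fun i ω => g i ω s)
        (fun i => (hgm i).comp measurable_prodMk_right) (fun i => (hgs i).1) (fun i => (hgs i).2)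
  have hE0 : ∀ᵐ s, E s = 0 := by
    refine hcov fun k => ?_
    obtain ⟨C, hC, hk⟩ := hdom k
    have hz : ∫⁻ s in Set.Icc (-k : ℝ) k, E s = 0 := by
      set M : ℝ≥0∞ := (2 * n + 1) * C with hM
      have hMt : M ≠ ⊤ := ENNReal.mul_ne_top (by finiteness) hC
      have hb : ∀ ε : ℝ, 0 < ε → ∫⁻ s in Set.Icc (-k : ℝ) k, E s ≤ ENNReal.ofReal (M.toReal * ε) := by
        intro ε hε
        obtain ⟨g, hgm, hgN, hgs⟩ := hkey ε hε
        calc ∫⁻ s in Set.Icc (-k : ℝ) k, E s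
            ≤ ∫⁻ s in Set.Icc (-k : ℝ) k, (2 * n + 1) * ∫⁻ x, ‖v x s - ∑ i, g i (x i) s‖ₑ ∂P :=
              lintegral_mono_ae (ae_restrict_of_ae (hgs.mono fun s hs => hs.2))
          _ = (2 * n + 1) * ∫⁻ s in Set.Icc (-k : ℝ) k, ∫⁻ x, ‖v x s - ∑ i, g i (x i) s‖ₑ ∂P :=
              lintegral_const_mul' _ _ (by finiteness)
          _ ≤ (2 * n + 1) * (C * ENNReal.ofReal ε) := by
              gcongr
              rw [hswap k hgm]
              exact (hk _ hgm).trans (by gcongr)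
          _ = ENNReal.ofReal (M.toReal * ε) := by
              rw [ENNReal.ofReal_mul ENNReal.toReal_nonneg, ENNReal.ofReal_toReal hMt, hM, mul_assoc]
      refine le_antisymm (ENNReal.le_of_forall_pos_le_add fun ε hε _ => ?_) bot_le
      have hε' : (0:ℝ) < ε := hε
      have hM0 : 0 ≤ M.toReal := ENNReal.toReal_nonneg
      refine (hb (ε / (M.toReal + 1)) (by positivity)).trans ?_
      rw [zero_add]
      refine ENNReal.ofReal_le_of_le_toReal ?_
      simp only [ENNReal.coe_toReal]
      rw [mul_div_assoc', div_le_iff₀ (by positivity)]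
      nlinarith
    exact (lintegral_eq_zero_iff hEm).1 hz
  obtain ⟨g, -, -, hgs⟩ := hkey 1 one_pos
  refine ⟨f, hfm, fun i => ?_, ?_⟩
  · filter_upwards [hgs, hE0] with s h1 h2
    refine ⟨h1.1 i, ?_⟩
    have := (add_eq_zero.1 h2).2
    rw [Finset.sum_eq_zero_iff] at this
    exact enorm_eq_zero.1 (this i (Finset.mem_univ i))
  · filter_upwards [hE0] with s h2
    have h3 := (add_eq_zero.1 h2).1
    have hm : Measurable fun x : Fin n → Ω => ‖v x s - ∑ i, f i (x i) s‖ₑ :=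
      (hdm.comp measurable_prodMk_right).enorm
    filter_upwards [(lintegral_eq_zero_iff hm).1 h3] with x hx
    exact sub_eq_zero.1 (enorm_eq_zero.1 hx)

theorem norm1_eq (μ : Measure Ω) {n : ℕ} (G : (Fin n → Ω) → ℝ → ℝ) :
    normL1L1R μ G = ∫⁻ x, ∫⁻ s, ‖G x s‖ₑ ∂volume ∂(Measure.pi fun _ => μ) := by
  unfold normL1L1R
  simp_rw [Real.enorm_eq_ofReal_abs]

theorem norm2_eq (μ : Measure Ω) {n : ℕ} (G : (Fin n → Ω) → ℝ → ℝ) :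
    normL1L2R μ G = ∫⁻ x, l2 volume (fun s => ‖G x s‖ₑ) ∂(Measure.pi fun _ => μ) := by
  unfold normL1L2R l2
  simp_rw [Real.enorm_eq_ofReal_abs, ← ENNReal.ofReal_pow (abs_nonneg _), sq_abs]

theorem dom1 (μ : Measure Ω) {n : ℕ} (k : ℕ) : ∃ C : ℝ≥0∞, C ≠ ⊤ ∧ ∀ G : (Fin n → Ω) → ℝ → ℝ,
      Measurable (Function.uncurry G) →
      ∫⁻ x, ∫⁻ s in Set.Icc (-k : ℝ) k, ‖G x s‖ₑ ∂volume ∂(Measure.pi fun _ => μ) ≤ C * normL1L1R μ G := by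
  refine ⟨1, by simp, fun G _ => ?_⟩
  rw [one_mul, norm1_eq]
  exact lintegral_mono fun x => setLIntegral_le_lintegral _ _

theorem dom2 (μ : Measure Ω) {n : ℕ} (k : ℕ) : ∃ C : ℝ≥0∞, C ≠ ⊤ ∧ ∀ G : (Fin n → Ω) → ℝ → ℝ,
      Measurable (Function.uncurry G) →
      ∫⁻ x, ∫⁻ s in Set.Icc (-k : ℝ) k, ‖G x s‖ₑ ∂volume ∂(Measure.pi fun _ => μ) ≤ C * normL1L2R μ G := by
  have hC : l2 (volume.restrict (Set.Icc (-k : ℝ) k)) (fun _ => 1) ≠ ⊤ := by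
    unfold l2
    exact ENNReal.rpow_ne_top_of_nonneg (by norm_num) (by simp)
  refine ⟨_, hC, fun G hG => ?_⟩
  rw [norm2_eq, ← lintegral_const_mul' _ _ hC]
  refine lintegral_mono fun x => ?_
  have hx : Measurable fun s => ‖G x s‖ₑ := (hG.comp measurable_prodMk_left).enorm
  have := cauchy_schwarz (ν := volume.restrict (Set.Icc (-k : ℝ) k)) (φ := fun _ => 1) (ψ := fun s => ‖G x s‖ₑ) measurable_const hx
  simp only [one_mul] at this
  refine this.trans ?_
  unfold l2
  gcongr
  exact Measure.restrict_le_self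

end KCl

namespace KCl

section
variable {R : Type*} [MeasurableSpace R]

/-- The symmetrization operator. -/
noncomputable def sy (μ : Measure Ω) {n : ℕ} (φ : (Fin n → Ω) → R → ℝ≥0∞)
    (x : Fin n → Ω) (s : R) : ℝ≥0∞ :=
  2 * ((2 ^ n)⁻¹ * ∑ A : Finset (Fin n),
    ∫⁻ y : Fin n → Ω, (φ (A.piecewise x y) s + φ (A.piecewise y x) s) ∂(Measure.pi fun _ => μ))

theorem measurable_pw {n : ℕ} (A : Finset (Fin n)) :
    Measurable (fun p : (Fin n → Ω) × (Fin n → Ω) => A.piecewise p.1 p.2) := by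
  refine measurable_pi_lambda _ fun i => ?_
  by_cases h : i ∈ A
  · simp only [Finset.piecewise, h, if_true]; fun_prop
  · simp only [Finset.piecewise, h, if_false]; fun_prop

theorem pw_meas1 {n : ℕ} (A : Finset (Fin n)) {φ : (Fin n → Ω) → R → ℝ≥0∞}
    (hφ : Measurable (Function.uncurry φ)) :
    Measurable fun z : ((Fin n → Ω) × R) × (Fin n → Ω) => φ (A.piecewise z.1.1 z.2) z.1.2 :=
  hφ.comp (f := fun z : ((Fin n → Ω) × R) × (Fin n → Ω) => (A.piecewise z.1.1 z.2, z.1.2))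
    (((measurable_pw A).comp (f := fun z : ((Fin n → Ω) × R) × (Fin n → Ω) => (z.1.1, z.2))
      (by fun_prop)).prodMk (by fun_prop))

theorem pw_meas2 {n : ℕ} (A : Finset (Fin n)) {φ : (Fin n → Ω) → R → ℝ≥0∞}
    (hφ : Measurable (Function.uncurry φ)) :
    Measurable fun z : ((Fin n → Ω) × R) × (Fin n → Ω) => φ (A.piecewise z.2 z.1.1) z.1.2 :=
  hφ.comp (f := fun z : ((Fin n → Ω) × R) × (Fin n → Ω) => (A.piecewise z.2 z.1.1, z.1.2))
    (((measurable_pw A).comp (f := fun z : ((Fin n → Ω) × R) × (Fin n → Ω) => (z.2, z.1.1))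
      (by fun_prop)).prodMk (by fun_prop))

theorem sy_int_measurable (μ : Measure Ω) [IsProbabilityMeasure μ] {n : ℕ} (A : Finset (Fin n))
    {φ : (Fin n → Ω) → R → ℝ≥0∞} (hφ : Measurable (Function.uncurry φ)) :
    Measurable fun z : (Fin n → Ω) × R =>
      ∫⁻ y : Fin n → Ω, (φ (A.piecewise z.1 y) z.2 + φ (A.piecewise y z.1) z.2)
        ∂(Measure.pi fun _ => μ) :=
  Measurable.lintegral_prod_right' ((pw_meas1 A hφ).add (pw_meas2 A hφ))

theorem sy_measurable (μ : Measure Ω) [IsProbabilityMeasure μ] {n : ℕ}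
    {φ : (Fin n → Ω) → R → ℝ≥0∞} (hφ : Measurable (Function.uncurry φ)) :
    Measurable (Function.uncurry (sy μ φ)) := by
  have : Measurable fun z : (Fin n → Ω) × R => ∑ A : Finset (Fin n),
      ∫⁻ y : Fin n → Ω, (φ (A.piecewise z.1 y) z.2 + φ (A.piecewise y z.1) z.2)
        ∂(Measure.pi fun _ => μ) :=
    Finset.measurable_fun_sum _ fun A _ => sy_int_measurable μ A hφ
  exact (this.const_mul _).const_mul _

theorem sy_add (μ : Measure Ω) [IsProbabilityMeasure μ] {n : ℕ}
    {φ ψ : (Fin n → Ω) → R → ℝ≥0∞} (hφ : Measurable (Function.uncurry φ)) (x s) :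
    sy μ (fun x s => φ x s + ψ x s) x s = sy μ φ x s + sy μ ψ x s := by
  unfold sy
  rw [← mul_add, ← mul_add, ← Finset.sum_add_distrib]
  congr 2
  refine Finset.sum_congr rfl fun A _ => ?_
  rw [← lintegral_add_left]
  · exact lintegral_congr fun y => by ring
  · exact ((pw_meas1 A hφ).add (pw_meas2 A hφ)).comp (f := fun y => ((x, s), y)) (by fun_prop)

theorem sy_l2 (μ : Measure Ω) [IsProbabilityMeasure μ] (ν : Measure R) [SFinite ν] {n : ℕ}
    {φ : (Fin n → Ω) → R → ℝ≥0∞} (hφ : Measurable (Function.uncurry φ)) :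
    ∫⁻ x, l2 ν (sy μ φ x) ∂(Measure.pi fun _ => μ)
      ≤ 4 * ∫⁻ x, l2 ν (φ x) ∂(Measure.pi fun _ => μ) := by
  set P : Measure (Fin n → Ω) := Measure.pi fun _ => μ with hP
  have hIm : ∀ A : Finset (Fin n), Measurable fun z : (Fin n → Ω) × R =>
      ∫⁻ y : Fin n → Ω, (φ (A.piecewise z.1 y) z.2 + φ (A.piecewise y z.1) z.2) ∂P :=
    fun A => sy_int_measurable μ A hφ
  have hIx : ∀ (A : Finset (Fin n)) (x : Fin n → Ω), Measurable fun s : R =>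
      ∫⁻ y : Fin n → Ω, (φ (A.piecewise x y) s + φ (A.piecewise y x) s) ∂P :=
    fun A x => (hIm A).comp measurable_prodMk_left
  have hl2 : Measurable fun x => l2 ν (φ x) := measurable_l2 hφ
  have hm1 : ∀ (A : Finset (Fin n)), Measurable fun p : (Fin n → Ω) × (Fin n → Ω) =>
      l2 ν (φ (A.piecewise p.1 p.2)) := fun A => hl2.comp (measurable_pw A)
  have hm2 : ∀ (A : Finset (Fin n)), Measurable fun p : (Fin n → Ω) × (Fin n → Ω) =>
      l2 ν (φ (A.piecewise p.2 p.1)) := fun A => (hm1 A).comp measurable_swap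
  have hφx : ∀ x, Measurable (φ x) := fun x => hφ.comp measurable_prodMk_left
  have hpt : ∀ x, l2 ν (sy μ φ x) ≤ 2 * ((2 ^ n)⁻¹ * ∑ A : Finset (Fin n),
      ∫⁻ y : Fin n → Ω, (l2 ν (φ (A.piecewise x y)) + l2 ν (φ (A.piecewise y x))) ∂P) := by
    intro x
    have hsm : Measurable fun s => ∑ A : Finset (Fin n),
      ∫⁻ y : Fin n → Ω, (φ (A.piecewise x y) s + φ (A.piecewise y x) s) ∂P :=
      Finset.measurable_fun_sum _ fun A _ => hIx A x
    have e : l2 ν (sy μ φ x) = 2 * ((2 ^ n)⁻¹ * l2 ν fun s => ∑ A : Finset (Fin n),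
      ∫⁻ y : Fin n → Ω, (φ (A.piecewise x y) s + φ (A.piecewise y x) s) ∂P) := by
      rw [← l2_const_mul _ hsm, ← l2_const_mul _ (hsm.const_mul _)]
      rfl
    rw [e]
    gcongr
    refine (l2_sum_le _ fun A => hIx A x).trans (Finset.sum_le_sum fun A _ => ?_)
    refine (minkowski P (φ := fun y s => φ (A.piecewise x y) s + φ (A.piecewise y x) s) ?_).trans ?_
    · exact ((pw_meas1 A hφ).add (pw_meas2 A hφ)).comp
        (f := fun z : (Fin n → Ω) × R => ((x, z.2), z.1)) (by fun_prop)
    · exact lintegral_mono fun y => l2_add_le (hφx _) (hφx _)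
  have hJm : ∀ A : Finset (Fin n), Measurable fun x : Fin n → Ω => ∫⁻ y : Fin n → Ω,
      (l2 ν (φ (A.piecewise x y)) + l2 ν (φ (A.piecewise y x))) ∂P := fun A =>
    Measurable.lintegral_prod_right' (f := fun p : (Fin n → Ω) × (Fin n → Ω) =>
      l2 ν (φ (A.piecewise p.1 p.2)) + l2 ν (φ (A.piecewise p.2 p.1))) ((hm1 A).add (hm2 A))
  calc ∫⁻ x, l2 ν (sy μ φ x) ∂P ≤ ∫⁻ x, 2 * ((2 ^ n)⁻¹ * ∑ A : Finset (Fin n),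
      ∫⁻ y : Fin n → Ω, (l2 ν (φ (A.piecewise x y)) + l2 ν (φ (A.piecewise y x))) ∂P) ∂P :=
        lintegral_mono hpt
    _ = 2 * ((2 ^ n)⁻¹ * ∑ A : Finset (Fin n), ∫⁻ x, ∫⁻ y : Fin n → Ω,
          (l2 ν (φ (A.piecewise x y)) + l2 ν (φ (A.piecewise y x))) ∂P ∂P) := by
        rw [lintegral_const_mul' _ _ (by simp), lintegral_const_mul' _ _ (by simp),
          lintegral_finsetSum _ fun A _ => hJm A]
    _ = 2 * ((2 ^ n)⁻¹ * ∑ A : Finset (Fin n), (2 * ∫⁻ x, l2 ν (φ x) ∂P)) := by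
        congr 2
        refine Finset.sum_congr rfl fun A _ => ?_
        rw [two_mul]
        nth_rewrite 1 [← lintegral_piecewise μ A hl2]
        rw [← lintegral_piecewise' μ A hl2, ← lintegral_add_left]
        · refine lintegral_congr fun x => ?_
          rw [lintegral_add_left]
          exact (hm1 A).comp measurable_prodMk_left
        · exact Measurable.lintegral_prod_right' (hm1 A)
    _ = 4 * ∫⁻ x, l2 ν (φ x) ∂P := by
        rw [Finset.sum_const, Finset.card_univ, Fintype.card_finset, Fintype.card_fin, nsmul_eq_mul]
        push_cast
        rw [← mul_assoc (2 ^ n)⁻¹, ENNReal.inv_mul_cancel (by simp) (by simp), one_mul, ← mul_assoc]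
        norm_num

theorem symm_bound (μ : Measure Ω) [IsProbabilityMeasure μ] {n : ℕ}
    {a : Fin n → Ω → ℝ} (ha : ∀ i, Measurable (a i)) (hai : ∀ i, Integrable (a i) μ)
    (ha0 : ∀ i, ∫ ω, a i ω ∂μ = 0) {φ : (Fin n → Ω) → R → ℝ≥0∞} (s : R)
    (hae : ∀ᵐ x ∂(Measure.pi fun _ : Fin n => μ), ‖∑ i, a i (x i)‖ₑ ≤ φ x s) :
    ∀ᵐ x ∂(Measure.pi fun _ : Fin n => μ), ∑ i, ‖a i (x i)‖ₑ ^ 2 ≤ (sy μ φ x s) ^ 2 := by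
  set P : Measure (Fin n → Ω) := Measure.pi fun _ => μ with hP
  have h1 : ∀ A : Finset (Fin n), ∀ᵐ x ∂P, ∀ᵐ y ∂P,
      ‖∑ i, a i (A.piecewise x y i)‖ₑ ≤ φ (A.piecewise x y) s := fun A =>
    Measure.ae_ae_of_ae_prod ((mp_piecewise μ A).quasiMeasurePreserving.ae hae)
  have h2 : ∀ A : Finset (Fin n), ∀ᵐ x ∂P, ∀ᵐ y ∂P,
      ‖∑ i, a i (A.piecewise y x i)‖ₑ ≤ φ (A.piecewise y x) s := fun A =>
    Measure.ae_ae_of_ae_prod (((mp_piecewise μ A).comp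
      (Measure.measurePreserving_swap (μ := P) (ν := P))).quasiMeasurePreserving.ae hae)
  have hax : ∀ i, Integrable (fun x : Fin n → Ω => a i (x i)) P := fun i =>
    (measurePreserving_eval (fun _ : Fin n => μ) i).integrable_comp_of_integrable (hai i)
  have hax0 : ∀ i, ∫ x : Fin n → Ω, a i (x i) ∂P = 0 := fun i => by
    rw [← ha0 i]
    exact integral_comp_eval (μ := fun _ : Fin n => μ) (ha i).aestronglyMeasurable
  filter_upwards [ae_all_iff.2 h1, ae_all_iff.2 h2] with x hx1 hx2
  refine (khintchine_enorm fun i => a i (x i)).trans ?_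
  unfold sy
  gcongr with A
  have i1 : ∀ i, Integrable (fun y : Fin n → Ω => a i (A.piecewise x y i)) P := by
    intro i
    by_cases h : i ∈ A
    · simp [h]
    · simpa [h] using hax i
  have i2 : ∀ i, Integrable (fun y : Fin n → Ω => a i (A.piecewise y x i)) P := by
    intro i
    by_cases h : i ∈ A
    · simpa [h] using hax i
    · simp [h]
  have e : (∑ i, if i ∈ A then a i (x i) else -a i (x i))
      = ∫ y : Fin n → Ω, (∑ i, a i (A.piecewise x y i) - ∑ i, a i (A.piecewise y x i)) ∂P := by
    rw [integral_sub (integrable_finsetSum _ fun i _ => i1 i)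
      (integrable_finsetSum _ fun i _ => i2 i), integral_finsetSum _ fun i _ => i1 i,
      integral_finsetSum _ fun i _ => i2 i, ← Finset.sum_sub_distrib]
    refine Finset.sum_congr rfl fun i _ => ?_
    by_cases h : i ∈ A
    · simp [h, hax0]
    · simp [h, hax0]
  rw [e]
  refine (enorm_integral_le_lintegral_enorm _).trans (lintegral_mono_ae ?_)
  filter_upwards [hx1 A, hx2 A] with y hy1 hy2
  exact enorm_sub_le.trans (add_le_add hy1 hy2)

end

end KCl

namespace KCl

theorem l2_unit (φ : Unit → ℝ≥0∞) : l2 (Measure.dirac ()) φ = φ () := by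
  unfold l2
  rw [lintegral_dirac, sq_sqrt]

theorem sy_l1 (μ : Measure Ω) [IsProbabilityMeasure μ] {n : ℕ}
    {φ : (Fin n → Ω) → ℝ → ℝ≥0∞} (hφ : Measurable (Function.uncurry φ)) (s : ℝ) :
    ∫⁻ x, sy μ φ x s ∂(Measure.pi fun _ => μ) ≤ 4 * ∫⁻ x, φ x s ∂(Measure.pi fun _ => μ) := by
  have h := sy_l2 μ (Measure.dirac ()) (φ := fun x (_ : Unit) => φ x s)
    (hφ.comp (f := fun z : (Fin n → Ω) × Unit => (z.1, s)) (by fun_prop))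
  simp_rw [l2_unit] at h
  exact h

theorem measurable_hit (μ : Measure Ω) [IsProbabilityMeasure μ] {n : ℕ} (i : Fin n)
    {Z : Set ((Fin n → Ω) × ℝ)} (hZ : MeasurableSet Z) :
    Measurable fun z : Ω × ℝ =>
      (Measure.pi fun _ => μ) {x : Fin n → Ω | (Function.update x i z.1, z.2) ∈ Z} := by
  have hm : Measurable fun q : (Ω × ℝ) × (Fin n → Ω) => (Function.update q.2 i q.1.1, q.1.2) :=
    ((measurable_upd i).comp (f := fun z : (Ω × ℝ) × (Fin n → Ω) => (z.1.1, z.2))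
      (by fun_prop)).prodMk (by fun_prop)
  exact measurable_measure_prodMk_left (hm hZ)

theorem core (μ : Measure Ω) [IsProbabilityMeasure μ] {n : ℕ}
    {f : Fin n → Ω → ℝ → ℝ} (hf : ∀ i, Measurable (Function.uncurry (f i)))
    {b c : (Fin n → Ω) → ℝ → ℝ≥0∞} (hb : Measurable (Function.uncurry b))
    (hc : Measurable (Function.uncurry c))
    (hbc : ∀ x s, ∑ i, ‖f i (x i) s‖ₑ ^ 2 ≤ (b x s + c x s) ^ 2)
    (hbfin : ∫⁻ s, ∫⁻ x, b x s ∂(Measure.pi fun _ => μ) ≠ ⊤)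
    (hcfin : ∫⁻ x, l2 volume (c x) ∂(Measure.pi fun _ => μ) ≠ ⊤) :
    ∃ g h : Fin n → Ω → ℝ → ℝ, (∀ i, Measurable (Function.uncurry (g i))) ∧
      (∀ i, Measurable (Function.uncurry (h i))) ∧ (∀ i ω s, f i ω s = g i ω s + h i ω s) ∧
      (∀ i, ∀ᵐ s, Integrable (fun ω => g i ω s) μ) ∧
      (∀ i, ∀ᵐ s, Integrable (fun ω => h i ω s) μ) ∧
      (∀ i, ∫⁻ s, ∫⁻ ω, ‖g i ω s‖ₑ ∂μ ≠ ⊤) ∧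
      (∀ i, ∫⁻ ω, l2 volume (fun s => ‖h i ω s‖ₑ) ∂μ ≠ ⊤) ∧
      (∫⁻ s, ∫⁻ x : Fin n → Ω, ‖∑ i, (g i (x i) s - ∫ ω, g i ω s ∂μ)‖ₑ ∂(Measure.pi fun _ => μ)
        ≤ 192 * ∫⁻ s, ∫⁻ x, b x s ∂(Measure.pi fun _ => μ)) ∧
      (∫⁻ x : Fin n → Ω, l2 volume (fun s => ‖∑ i, (h i (x i) s - ∫ ω, h i ω s ∂μ)‖ₑ)
          ∂(Measure.pi fun _ => μ)
        ≤ 192 * ∫⁻ x, l2 volume (c x) ∂(Measure.pi fun _ => μ)) := by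
  set P : Measure (Fin n → Ω) := Measure.pi fun _ => μ with hP
  set Z : Set ((Fin n → Ω) × ℝ) := {z | b z.1 z.2 ≤ c z.1 z.2} with hZd
  have hZ : MeasurableSet Z := measurableSet_le hb hc
  set p : Fin n → Ω → ℝ → ℝ≥0∞ := fun i ω s =>
    P {x : Fin n → Ω | (Function.update x i ω, s) ∈ Z} with hp
  have hpm : ∀ i, Measurable (Function.uncurry (p i)) := fun i => measurable_hit μ i hZ
  set g : Fin n → Ω → ℝ → ℝ := fun i ω s => if 1 / 2 ≤ p i ω s then 0 else f i ω s with hg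
  set h : Fin n → Ω → ℝ → ℝ := fun i ω s => if 1 / 2 ≤ p i ω s then f i ω s else 0 with hh
  have hset : ∀ i, MeasurableSet {z : Ω × ℝ | 1 / 2 ≤ p i z.1 z.2} := fun i =>
    measurableSet_le measurable_const (hpm i)
  have hgm : ∀ i, Measurable (Function.uncurry (g i)) := fun i =>
    Measurable.ite (hset i) measurable_const (hf i)
  have hhm : ∀ i, Measurable (Function.uncurry (h i)) := fun i =>
    Measurable.ite (hset i) (hf i) measurable_const
  have hadd : ∀ i ω s, f i ω s = g i ω s + h i ω s := by
    intro i ω s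
    by_cases hi : 1 / 2 ≤ p i ω s <;> simp only [hg, hh, hi, if_true, if_false, zero_add, add_zero]
  have hgle : ∀ i ω s, ‖g i ω s‖ₑ ≤ ‖f i ω s‖ₑ := by
    intro i ω s
    by_cases hi : 1 / 2 ≤ p i ω s <;> simp only [hg, hi, if_true, if_false, enorm_zero] <;> simp
  have hhle : ∀ i ω s, ‖h i ω s‖ₑ ≤ ‖f i ω s‖ₑ := by
    intro i ω s
    by_cases hi : 1 / 2 ≤ p i ω s <;> simp only [hh, hi, if_true, if_false, enorm_zero] <;> simp
  have AB1 := lemAB μ volume hhm hc hZ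
    (by
      intro x s hx
      have hx' : b x s ≤ c x s := hx
      calc ∑ i, ‖h i (x i) s‖ₑ ^ 2 ≤ ∑ i, ‖f i (x i) s‖ₑ ^ 2 := by
            gcongr with i; exact hhle _ _ _
        _ ≤ (b x s + c x s) ^ 2 := hbc x s
        _ ≤ (2 * c x s) ^ 2 := by rw [two_mul]; gcongr)
    (by
      intro i ω s h0
      by_contra hcon
      exact h0 (if_neg hcon))
    hcfin
  have AB2 : ∀ s, ∫⁻ x, b x s ∂P ≠ ⊤ →
      (∀ i, ∫⁻ ω, ‖g i ω s‖ₑ ∂μ ≤ 4 * ∫⁻ x, b x s ∂P) ∧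
      (∀ i, Integrable (fun ω => g i ω s) μ) ∧
      ∫⁻ x : Fin n → Ω, ‖∑ i, (g i (x i) s - ∫ ω, g i ω s ∂μ)‖ₑ ∂P ≤ 192 * ∫⁻ x, b x s ∂P := by
    intro s hs
    have := lemAB μ (Measure.dirac ()) (R := Unit) (h := fun i ω _ => g i ω s)
      (c := fun x _ => b x s) (Z := {z : (Fin n → Ω) × Unit | (z.1, s) ∉ Z})
      (fun i => (hgm i).comp (f := fun z : Ω × Unit => (z.1, s)) (by fun_prop))
      (hb.comp (f := fun z : (Fin n → Ω) × Unit => (z.1, s)) (by fun_prop))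
      ((show Measurable fun z : (Fin n → Ω) × Unit => (z.1, s) by fun_prop) hZ.compl)
      (by
        intro x _ hx
        have hx' : c x s ≤ b x s := by
          have hx2 : ¬ (b x s ≤ c x s) := hx
          exact (not_le.1 hx2).le
        calc ∑ i, ‖g i (x i) s‖ₑ ^ 2 ≤ ∑ i, ‖f i (x i) s‖ₑ ^ 2 := by
              gcongr with i; exact hgle _ _ _
          _ ≤ (b x s + c x s) ^ 2 := hbc x s
          _ ≤ (2 * b x s) ^ 2 := by rw [two_mul]; gcongr)
      (by
        intro i ω _ h0
        have hlt : p i ω s < 1 / 2 := by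
          by_contra hcon
          exact h0 (if_pos (not_lt.1 hcon))
        have hms : MeasurableSet {x : Fin n → Ω | (Function.update x i ω, s) ∈ Z} :=
          (((measurable_upd i).comp (f := fun x : Fin n → Ω => (ω, x)) (by fun_prop)).prodMk
            measurable_const) hZ
        have h1 := prob_compl_eq_one_sub (μ := P) hms
        have h2 : {x : Fin n → Ω | (Function.update x i ω, ()) ∈
            {z : (Fin n → Ω) × Unit | (z.1, s) ∉ Z}}
            = {x : Fin n → Ω | (Function.update x i ω, s) ∈ Z}ᶜ := rfl
        change 1 / 2 ≤ P {x : Fin n → Ω | (Function.update x i ω, s) ∈ Z}ᶜ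
        rw [h1]
        refine ENNReal.le_sub_of_add_le_right (measure_ne_top _ _) ?_
        calc (1 / 2 : ℝ≥0∞) + P {x : Fin n → Ω | (Function.update x i ω, s) ∈ Z}
            ≤ 1 / 2 + 1 / 2 := add_le_add le_rfl hlt.le
          _ = 1 := ENNReal.add_halves 1)
      (by simp_rw [l2_unit]; exact hs)
    simp_rw [l2_unit] at this
    refine ⟨this.1, fun i => ?_, this.2.2⟩
    have h1 := this.2.1 i
    rw [ae_dirac_eq] at h1
    exact h1
  have hbm : Measurable fun s => ∫⁻ x, b x s ∂P := Measurable.lintegral_prod_left' hb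
  have hae : ∀ᵐ s, ∫⁻ x, b x s ∂P ≠ ⊤ := (ae_lt_top hbm hbfin).mono fun s hs => hs.ne
  refine ⟨g, h, hgm, hhm, hadd, fun i => ?_, AB1.2.1, fun i => ?_, fun i => ?_, ?_, AB1.2.2⟩
  · exact hae.mono fun s hs => (AB2 s hs).2.1 i
  · refine ne_top_of_le_ne_top (ENNReal.mul_ne_top (a := 4) (by simp) hbfin) ?_
    rw [← lintegral_const_mul' _ _ (by simp)]
    exact lintegral_mono_ae (hae.mono fun s hs => (AB2 s hs).1 i)
  · exact ne_top_of_le_ne_top (ENNReal.mul_ne_top (by simp) hcfin) (AB1.1 i)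
  · rw [← lintegral_const_mul' _ _ (by simp)]
    exact lintegral_mono_ae (hae.mono fun s hs => (AB2 s hs).2.2)

theorem memV_of (μ : Measure Ω) [IsProbabilityMeasure μ] {n : ℕ}
    {N : ((Fin n → Ω) → ℝ → ℝ) → ℝ≥0∞} (hN0 : N (fun _ _ => 0) = 0)
    {g : Fin n → Ω → ℝ → ℝ} (hg : ∀ i, Measurable (Function.uncurry (g i)))
    (hgi : ∀ i, ∀ᵐ s, Integrable (fun ω => g i ω s) μ)
    (hN : N (fun x s => ∑ i, (g i (x i) s - ∫ ω, g i ω s ∂μ)) < ⊤)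
    (hNi : ∀ i, N (fun x s => g i (x i) s - ∫ ω, g i ω s ∂μ) < ⊤) :
    MemV11 μ N (fun x s => ∑ i, (g i (x i) s - ∫ ω, g i ω s ∂μ)) := by
  refine ⟨measurable_centered μ hg, hN, fun ε hε =>
    ⟨fun i ω s => g i ω s - ∫ ω, g i ω s ∂μ, fun i => ?_, fun i => ?_, hNi, ?_⟩⟩
  · exact (hg i).sub ((measurable_mean μ (hg i)).comp measurable_snd)
  · filter_upwards [hgi i] with s hs
    refine ⟨hs.sub (integrable_const _), ?_⟩
    rw [integral_sub hs (integrable_const _)]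
    simp
  · simp only [sub_self, hN0]
    exact bot_le

theorem fin1 (μ : Measure Ω) [IsProbabilityMeasure μ] {n : ℕ} (i : Fin n)
    {g : Ω → ℝ → ℝ} (hg : Measurable (Function.uncurry g))
    (hfin : ∫⁻ s, ∫⁻ ω, ‖g ω s‖ₑ ∂μ ≠ ⊤) :
    normL1L1R μ (fun x : Fin n → Ω => fun s => g (x i) s - ∫ ω, g ω s ∂μ) < ⊤ := by
  rw [norm1_eq]
  have hm : Measurable (Function.uncurry fun ω s => g ω s - ∫ ω, g ω s ∂μ) :=
    hg.sub ((measurable_mean μ hg).comp measurable_snd)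
  rw [lintegral_eval μ i (φ := fun ω => ∫⁻ s, ‖g ω s - ∫ ω, g ω s ∂μ‖ₑ)
    (Measurable.lintegral_prod_right' hm.enorm), lintegral_lintegral_swap hm.enorm.aemeasurable]
  calc ∫⁻ s, ∫⁻ ω, ‖g ω s - ∫ ω, g ω s ∂μ‖ₑ ∂μ
      ≤ ∫⁻ s, 2 * ∫⁻ ω, ‖g ω s‖ₑ ∂μ := by
        refine lintegral_mono fun s => ?_
        calc ∫⁻ ω, ‖g ω s - ∫ ω, g ω s ∂μ‖ₑ ∂μ
            ≤ ∫⁻ ω, (‖g ω s‖ₑ + ∫⁻ ω, ‖g ω s‖ₑ ∂μ) ∂μ :=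
              lintegral_mono fun ω => enorm_sub_le.trans
                (by gcongr; exact enorm_integral_le_lintegral_enorm _)
          _ = _ := by
              rw [lintegral_add_right _ measurable_const, lintegral_const, measure_univ, mul_one,
                two_mul]
    _ = 2 * ∫⁻ s, ∫⁻ ω, ‖g ω s‖ₑ ∂μ := lintegral_const_mul' _ _ (by simp)
    _ < ⊤ := ENNReal.mul_lt_top (by simp) hfin.lt_top

theorem fin2 (μ : Measure Ω) [IsProbabilityMeasure μ] {n : ℕ} (i : Fin n)
    {g : Ω → ℝ → ℝ} (hg : Measurable (Function.uncurry g))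
    (hfin : ∫⁻ ω, l2 volume (fun s => ‖g ω s‖ₑ) ∂μ ≠ ⊤) :
    normL1L2R μ (fun x : Fin n → Ω => fun s => g (x i) s - ∫ ω, g ω s ∂μ) < ⊤ := by
  rw [norm2_eq]
  have hm : Measurable (Function.uncurry fun ω s => g ω s - ∫ ω, g ω s ∂μ) :=
    hg.sub ((measurable_mean μ hg).comp measurable_snd)
  rw [lintegral_eval μ i (φ := fun ω => l2 volume fun s => ‖g ω s - ∫ ω, g ω s ∂μ‖ₑ)
    (measurable_l2 hm.enorm)]
  have hgx : ∀ ω, Measurable fun s => ‖g ω s‖ₑ := fun ω =>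
    (hg.comp measurable_prodMk_left).enorm
  have hgi : Measurable fun s => ∫⁻ ω, ‖g ω s‖ₑ ∂μ :=
    Measurable.lintegral_prod_left' (f := fun z : Ω × ℝ => ‖g z.1 z.2‖ₑ) hg.enorm
  calc ∫⁻ ω, l2 volume (fun s => ‖g ω s - ∫ ω, g ω s ∂μ‖ₑ) ∂μ
      ≤ ∫⁻ ω, (l2 volume (fun s => ‖g ω s‖ₑ) + ∫⁻ ω, l2 volume (fun s => ‖g ω s‖ₑ) ∂μ) ∂μ := by
        refine lintegral_mono fun ω => ?_
        refine (l2_mono (ψ := fun s => ‖g ω s‖ₑ + ∫⁻ ω, ‖g ω s‖ₑ ∂μ) fun s =>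
          enorm_sub_le.trans (by gcongr; exact enorm_integral_le_lintegral_enorm _)).trans ?_
        refine (l2_add_le (hgx ω) hgi).trans ?_
        gcongr
        exact minkowski μ (φ := fun ω s => ‖g ω s‖ₑ) hg.enorm
    _ = 2 * ∫⁻ ω, l2 volume (fun s => ‖g ω s‖ₑ) ∂μ := by
        rw [lintegral_add_right _ measurable_const, lintegral_const, measure_univ, mul_one, two_mul]
    _ < ⊤ := ENNReal.mul_lt_top (by simp) hfin.lt_top

theorem ae_swap' (μ : Measure Ω) [IsProbabilityMeasure μ] {n : ℕ}
    {q : (Fin n → Ω) → ℝ → Prop}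
    (h : ∀ᵐ z ∂((Measure.pi fun _ : Fin n => μ).prod (volume : Measure ℝ)), q z.1 z.2) :
    ∀ᵐ s, ∀ᵐ x ∂(Measure.pi fun _ : Fin n => μ), q x s := by
  have h1 := (Measure.measurePreserving_swap (μ := (volume : Measure ℝ))
    (ν := Measure.pi fun _ : Fin n => μ)).quasiMeasurePreserving.ae h
  exact Measure.ae_ae_of_ae_prod h1

theorem kcl_main (μ : Measure Ω) [IsProbabilityMeasure μ]
    (n : ℕ) (F F₀ F₁ : (Fin n → Ω) → ℝ → ℝ) (t : ℝ)
    (hF : ∃ u v : (Fin n → Ω) → ℝ → ℝ, MemV11 μ (normL1L1R μ) u ∧ MemV11 μ (normL1L2R μ) v ∧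
      ∀ᵐ z ∂((Measure.pi fun _ : Fin n => μ).prod volume),
        F z.1 z.2 = u z.1 z.2 + v z.1 z.2)
    (hF₀ : Measurable (Function.uncurry F₀)) (hF₁ : Measurable (Function.uncurry F₁))
    (hN₀ : normL1L1R μ F₀ < ⊤) (hN₁ : normL1L2R μ F₁ < ⊤)
    (hdec : ∀ᵐ z ∂((Measure.pi fun _ : Fin n => μ).prod volume),
      F z.1 z.2 = F₀ z.1 z.2 + F₁ z.1 z.2) :
    ∃ G₀ G₁ : (Fin n → Ω) → ℝ → ℝ,
      MemV11 μ (normL1L1R μ) G₀ ∧ MemV11 μ (normL1L2R μ) G₁ ∧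
      (∀ᵐ z ∂((Measure.pi fun _ : Fin n => μ).prod volume),
        F z.1 z.2 = G₀ z.1 z.2 + G₁ z.1 z.2) ∧
      normL1L1R μ G₀ + ENNReal.ofReal t * normL1L2R μ G₁
        ≤ ENNReal.ofReal 768 * (normL1L1R μ F₀ + ENNReal.ofReal t * normL1L2R μ F₁) := by
  obtain ⟨u, v, hu, hv, huv⟩ := hF
  obtain ⟨fu, hfum, hfu0, hfu⟩ := extract μ (dom1 μ) hu
  obtain ⟨fv, hfvm, hfv0, hfv⟩ := extract μ (dom2 μ) hv
  have hum := hu.1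
  have huv' := ae_swap' μ (q := fun x s => F x s = u x s + v x s) huv
  have hdec' := ae_swap' μ (q := fun x s => F x s = F₀ x s + F₁ x s) hdec
  have hvm := hv.1
  set P : Measure (Fin n → Ω) := Measure.pi fun _ => μ with hP
  set f : Fin n → Ω → ℝ → ℝ := fun i ω s => fu i ω s + fv i ω s with hf
  have hfm : ∀ i, Measurable (Function.uncurry (f i)) := fun i => (hfum i).add (hfvm i)
  have hf0 : ∀ i, ∀ᵐ s, Integrable (fun ω => f i ω s) μ ∧ ∫ ω, f i ω s ∂μ = 0 := by
    intro i
    filter_upwards [hfu0 i, hfv0 i] with s h1 h2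
    refine ⟨h1.1.add h2.1, ?_⟩
    simp only [hf]
    rw [integral_add h1.1 h2.1, h1.2, h2.2, add_zero]
  have hsum : ∀ᵐ s, ∀ᵐ x ∂P, u x s + v x s = ∑ i, f i (x i) s := by
    filter_upwards [hfu, hfv] with s h1 h2
    filter_upwards [h1, h2] with x h3 h4
    rw [h3, h4, ← Finset.sum_add_distrib]
  set φ₀ : (Fin n → Ω) → ℝ → ℝ≥0∞ := fun x s => ‖F₀ x s‖ₑ with hφ₀
  set φ₁ : (Fin n → Ω) → ℝ → ℝ≥0∞ := fun x s => ‖F₁ x s‖ₑ with hφ₁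
  have hφ₀m : Measurable (Function.uncurry φ₀) := hF₀.enorm
  have hφ₁m : Measurable (Function.uncurry φ₁) := hF₁.enorm
  set b₀ := sy μ φ₀ with hb₀
  set c := sy μ φ₁ with hc
  have hb₀m : Measurable (Function.uncurry b₀) := sy_measurable μ hφ₀m
  have hcm : Measurable (Function.uncurry c) := sy_measurable μ hφ₁m
  have hgood : ∀ᵐ s, ∀ᵐ x ∂P, ∑ i, ‖f i (x i) s‖ₑ ^ 2 ≤ (b₀ x s + c x s) ^ 2 := by
    filter_upwards [hsum, ae_all_iff.2 hf0, huv', hdec'] with s h1 h2 h3 h4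
    have := symm_bound μ (a := fun i ω => f i ω s)
      (fun i => (hfm i).comp measurable_prodMk_right) (fun i => (h2 i).1) (fun i => (h2 i).2)
      (φ := fun x s => φ₀ x s + φ₁ x s) s (by
        filter_upwards [h1, h3, h4] with x e1 e2 e3
        rw [← e1, ← e2, e3]
        exact enorm_add_le _ _)
    filter_upwards [this] with x hx
    rwa [sy_add μ hφ₀m] at hx
  set T : Set ((Fin n → Ω) × ℝ) :=
    {z | ∑ i, ‖f i (z.1 i) z.2‖ₑ ^ 2 ≤ (b₀ z.1 z.2 + c z.1 z.2) ^ 2} with hT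
  have hTm : MeasurableSet T := by
    refine measurableSet_le ?_ ((hb₀m.add hcm).pow_const 2)
    exact Finset.measurable_fun_sum _ fun i _ => ((hfm i).comp
      (f := fun z : (Fin n → Ω) × ℝ => (z.1 i, z.2)) (by fun_prop)).enorm.pow_const 2
  classical
  set b : (Fin n → Ω) → ℝ → ℝ≥0∞ := fun x s => if (x, s) ∈ T then b₀ x s else ⊤ with hb
  have hbm : Measurable (Function.uncurry b) := Measurable.ite hTm hb₀m measurable_const
  have hbint : ∫⁻ s, ∫⁻ x, b x s ∂P ≤ 4 * normL1L1R μ F₀ := by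
    calc ∫⁻ s, ∫⁻ x, b x s ∂P ≤ ∫⁻ s, 4 * ∫⁻ x, φ₀ x s ∂P := by
          refine lintegral_mono_ae (hgood.mono fun s hs => ?_)
          refine le_trans (lintegral_mono_ae (hs.mono fun x hx => ?_)) (sy_l1 μ hφ₀m s)
          have hx' : (x, s) ∈ T := hx
          simp only [hb, hx', if_true]
          exact le_rfl
      _ = 4 * ∫⁻ s, ∫⁻ x, φ₀ x s ∂P := lintegral_const_mul' _ _ (by simp)
      _ = 4 * normL1L1R μ F₀ := by
          rw [norm1_eq, lintegral_lintegral_swap hφ₀m.aemeasurable]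
  have hcint : ∫⁻ x, l2 volume (c x) ∂P ≤ 4 * normL1L2R μ F₁ := by
    rw [norm2_eq]
    exact sy_l2 μ volume hφ₁m
  obtain ⟨g, h, hgm, hhm, hadd, hgi, hhi, hgf, hhf, hG, hH⟩ := core μ hfm hbm hcm
    (by
      intro x s
      by_cases hx : (x, s) ∈ T
      · simp only [hb, hx, if_true]
        exact hx
      · simp [hb, hx])
    (hbint.trans_lt (ENNReal.mul_lt_top (by simp) hN₀)).ne
    (hcint.trans_lt (ENNReal.mul_lt_top (by simp) hN₁)).ne
  have hGm := measurable_centered μ hgm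
  have hHm := measurable_centered μ hhm
  have hG' : normL1L1R μ (fun x s => ∑ i, (g i (x i) s - ∫ ω, g i ω s ∂μ))
      ≤ 768 * normL1L1R μ F₀ := by
    rw [norm1_eq, lintegral_lintegral_swap hGm.enorm.aemeasurable]
    refine (hG.trans (mul_le_mul_right hbint _)).trans (le_of_eq ?_)
    rw [← mul_assoc]; norm_num
  have hH' : normL1L2R μ (fun x s => ∑ i, (h i (x i) s - ∫ ω, h i ω s ∂μ))
      ≤ 768 * normL1L2R μ F₁ := by
    rw [norm2_eq]
    refine (hH.trans (mul_le_mul_right hcint _)).trans (le_of_eq ?_)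
    rw [← mul_assoc]; norm_num
  refine ⟨fun x s => ∑ i, (g i (x i) s - ∫ ω, g i ω s ∂μ),
    fun x s => ∑ i, (h i (x i) s - ∫ ω, h i ω s ∂μ), ?_, ?_, ?_, ?_⟩
  · refine memV_of μ (by rw [norm1_eq]; simp) hgm hgi
      (hG'.trans_lt (ENNReal.mul_lt_top (by simp) hN₀)) fun i => fin1 μ i (hgm i) (hgf i)
  · refine memV_of μ (by rw [norm2_eq]; simp [l2]) hhm hhi
      (hH'.trans_lt (ENNReal.mul_lt_top (by simp) hN₁)) fun i => fin2 μ i (hhm i) (hhf i)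
  · have hae : ∀ᵐ s, ∀ᵐ x ∂P, u x s + v x s = ∑ i, (g i (x i) s - ∫ ω, g i ω s ∂μ)
        + ∑ i, (h i (x i) s - ∫ ω, h i ω s ∂μ) := by
      filter_upwards [hsum, ae_all_iff.2 hf0, ae_all_iff.2 hgi, ae_all_iff.2 hhi] with s h1 h2 h3 h4
      filter_upwards [h1] with x hx
      rw [hx, ← Finset.sum_add_distrib]
      refine Finset.sum_congr rfl fun i _ => ?_
      have h5 : ∫ ω, g i ω s ∂μ + ∫ ω, h i ω s ∂μ = 0 := by
        rw [← integral_add (h3 i) (h4 i), ← (h2 i).2]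
        exact integral_congr_ae (ae_of_all _ fun ω => (hadd i ω s).symm)
      rw [hadd]
      linarith
    have hms : MeasurableSet {z : ℝ × (Fin n → Ω) | u z.2 z.1 + v z.2 z.1
        = ∑ i, (g i (z.2 i) z.1 - ∫ ω, g i ω z.1 ∂μ)
        + ∑ i, (h i (z.2 i) z.1 - ∫ ω, h i ω z.1 ∂μ)} :=
      measurableSet_eq_fun ((hum.comp measurable_swap).add (hvm.comp measurable_swap))
        ((hGm.comp measurable_swap).add (hHm.comp measurable_swap))
    have h6 := (Measure.ae_prod_iff_ae_ae (μ := (volume : Measure ℝ)) (ν := P) hms).2 hae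
    have h7 := (Measure.measurePreserving_swap (μ := P)
      (ν := (volume : Measure ℝ))).quasiMeasurePreserving.ae h6
    filter_upwards [huv, h7] with z h8 h9
    rw [h8]
    exact h9
  · rw [ENNReal.ofReal_ofNat]
    calc _ ≤ 768 * normL1L1R μ F₀ + ENNReal.ofReal t * (768 * normL1L2R μ F₁) := by gcongr
      _ = _ := by ring

end KCl

/-- **K-closedness of `(V^1_1(Ω^n, L¹(ℝ)), V^1_1(Ω^n, L²(ℝ)))` in
`(L¹(Ω^n, L¹(ℝ)), L¹(Ω^n, L²(ℝ)))`** (Theorem `kclv1l1` of the paper), with a constant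
independent of `n`: every decomposition of `f ∈ V^1_1(L¹) + V^1_1(L²)` in the big couple
can be replaced by a decomposition within the Hoeffding subspaces with comparable
`K`-functional. -/
theorem kClosed_V11_L1_L2 :
    ∃ C : ℝ, 0 < C ∧
      ∀ (Ω : Type u) [MeasurableSpace Ω] (μ : Measure Ω) [IsProbabilityMeasure μ]
        (n : ℕ) (F F₀ F₁ : (Fin n → Ω) → ℝ → ℝ) (t : ℝ), 0 < t →
        (∃ u v : (Fin n → Ω) → ℝ → ℝ, MemV11 μ (normL1L1R μ) u ∧ MemV11 μ (normL1L2R μ) v ∧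
          ∀ᵐ z ∂((Measure.pi fun _ : Fin n => μ).prod volume),
            F z.1 z.2 = u z.1 z.2 + v z.1 z.2) →
        Measurable (Function.uncurry F₀) → Measurable (Function.uncurry F₁) →
        normL1L1R μ F₀ < ⊤ → normL1L2R μ F₁ < ⊤ →
        (∀ᵐ z ∂((Measure.pi fun _ : Fin n => μ).prod volume),
          F z.1 z.2 = F₀ z.1 z.2 + F₁ z.1 z.2) →
        ∃ G₀ G₁ : (Fin n → Ω) → ℝ → ℝ,
          MemV11 μ (normL1L1R μ) G₀ ∧ MemV11 μ (normL1L2R μ) G₁ ∧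
          (∀ᵐ z ∂((Measure.pi fun _ : Fin n => μ).prod volume),
            F z.1 z.2 = G₀ z.1 z.2 + G₁ z.1 z.2) ∧
          normL1L1R μ G₀ + ENNReal.ofReal t * normL1L2R μ G₁
            ≤ ENNReal.ofReal C * (normL1L1R μ F₀ + ENNReal.ofReal t * normL1L2R μ F₁) := by
  refine ⟨768, by norm_num, ?_⟩
  intro Ω _ μ _ n F F₀ F₁ t _ hF h0 h1 h2 h3 h4
  exact KCl.kcl_main μ n F F₀ F₁ t hF h0 h1 h2 h3 h4
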